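/- arXiv:math/9910094 — 4 statements merged into one kernel-verified Lean document; each statement's English description precedes it below -/
import Mathlib

section
/- Let n ≥ 1 and let g ⊂ Vect_Pol(ℝ^n) be the Lie subalgebra spanned by the vector fields ∂_i (1 ≤ i ≤ n), x^i ∂_j (1 ≤ i, j ≤ n), and x^i E (1 ≤ i ≤ n), where E = x^j ∂_j (a subalgebra isomorphic to sl(n+1, ℝ)). Then g is a maximal Lie subalgebra of Vect_Pol(ℝ^n): every Lie subalgebra h with g ⊊ h ⊆ Vect_Pol(ℝ^n) equals Vect_Pol(ℝ^n). -/
set_option maxHeartbeats 1000000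

open MvPolynomial

/-- Polynomial vector fields on ℝⁿ: `n`-tuples of polynomial coefficients. -/
abbrev VectPol (n : ℕ) := Fin n → MvPolynomial (Fin n) ℝ

/-- The Lie bracket of polynomial vector fields:
`[X, Y]^j = Σᵢ (Xⁱ ∂ᵢYʲ − Yⁱ ∂ᵢXʲ)`. -/
noncomputable def vbracket {n : ℕ} (Xv Yv : VectPol n) : VectPol n :=
  fun j => ∑ i, (Xv i * pderiv i (Yv j) - Yv i * pderiv i (Xv j))

/-- The projective generators: `∂ᵢ`, `xⁱ∂ⱼ`, and `xⁱE` where `E = xʲ∂ⱼ`. -/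
noncomputable def projGen (n : ℕ) : Set (VectPol n) :=
  (Set.range fun i : Fin n => (fun k => if k = i then 1 else 0 : VectPol n)) ∪
  (Set.range fun p : Fin n × Fin n =>
    (fun k => if k = p.2 then X p.1 else 0 : VectPol n)) ∪
  (Set.range fun i : Fin n => (fun k => X i * X k : VectPol n))

theorem br_ss {n : ℕ} (i j : Fin n) (f g : MvPolynomial (Fin n) ℝ) :
    vbracket (Pi.single i f) (Pi.single j g) =
      Pi.single j (f * pderiv i g) - Pi.single i (g * pderiv j f) := by
  funext k
  simp only [vbracket, Finset.sum_sub_distrib, Pi.sub_apply, Pi.single_apply]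
  congr 1
  · simp only [ite_mul, zero_mul, Finset.sum_ite_eq', Finset.mem_univ, if_true]
    split_ifs <;> simp
  · simp only [ite_mul, zero_mul, Finset.sum_ite_eq', Finset.mem_univ, if_true]
    split_ifs <;> simp

noncomputable def DD {n : ℕ} (c : Fin n → ℝ) (P : MvPolynomial (Fin n) ℝ) : VectPol n :=
  fun k => C (c k) * X k * P

theorem br_left {n : ℕ} (b : Fin n) (f : MvPolynomial (Fin n) ℝ) (Y : VectPol n) (k : Fin n) :
    vbracket (Pi.single b f) Y k = f * pderiv b (Y k) -
      if k = b then ∑ i, Y i * pderiv i f else 0 := by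
  simp only [vbracket, Finset.sum_sub_distrib, Pi.single_apply]
  congr 1
  · simp only [ite_mul, zero_mul, Finset.sum_ite_eq', Finset.mem_univ, if_true]
  · split_ifs <;> simp

theorem br_X {n : ℕ} (a b : Fin n) (Y : VectPol n) (k : Fin n) :
    vbracket (Pi.single b (X a)) Y k = X a * pderiv b (Y k) - if k = b then Y a else 0 := by
  rw [br_left]
  simp [pderiv_X, Pi.single_apply]

theorem br_one {n : ℕ} (b : Fin n) (Y : VectPol n) (k : Fin n) :
    vbracket (Pi.single b 1) Y k = pderiv b (Y k) := by
  rw [br_left]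
  simp

theorem coeff_tor {n : ℕ} (i : Fin n) (Y : VectPol n) (k : Fin n) (a : Fin n →₀ ℕ) :
    coeff a (vbracket (Pi.single i (X i)) Y k) =
      ((a i : ℝ) - if k = i then 1 else 0) * coeff a (Y k) := by
  rw [br_X, coeff_sub, sub_mul]
  congr 1
  · induction Y k using MvPolynomial.induction_on' with
    | monomial u r =>
      rw [X_mul_pderiv_monomial]
      simp only [nsmul_eq_mul, coeff_monomial, ← C_eq_coe_nat, coeff_C_mul]
      split_ifs with h
      · subst h; simp
      · simp
    | add p q hp hq => simp only [map_add, mul_add, coeff_add, hp, hq]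
  · split_ifs with h <;> simp [h]

def IsWt {n : ℕ} (Y : VectPol n) : Prop :=
  ∀ j k : Fin n, ∀ a b : Fin n →₀ ℕ, coeff a (Y j) ≠ 0 → coeff b (Y k) ≠ 0 → ∀ i,
    ((a i : ℝ) - if j = i then 1 else 0) = ((b i : ℝ) - if k = i then 1 else 0)

theorem size_lt {n : ℕ} (Y : VectPol n) (i j : Fin n) (a : Fin n →₀ ℕ) (ha : coeff a (Y j) ≠ 0) :
    ∑ k, ((vbracket (Pi.single i (X i)) Y -
      ((a i : ℝ) - if j = i then 1 else 0) • Y) k).support.card < ∑ k, (Y k).support.card := by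
  have key : ∀ k, ((vbracket (Pi.single i (X i)) Y -
      ((a i : ℝ) - if j = i then 1 else 0) • Y) k).support ⊆ (Y k).support := by
    intro k b
    simp only [mem_support_iff, Pi.sub_apply, Pi.smul_apply, coeff_sub, coeff_smul, coeff_tor]
    intro h1 h2
    apply h1
    simp [h2]
  apply Finset.sum_lt_sum
  · intro k _
    exact Finset.card_le_card (key k)
  · refine ⟨j, Finset.mem_univ _, Finset.card_lt_card ?_⟩
    refine Finset.ssubset_iff_subset_ne.2 ⟨key j, fun he => ?_⟩
    have := mem_support_iff.2 ha
    rw [← he, mem_support_iff] at this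
    apply this
    simp only [Pi.sub_apply, Pi.smul_apply, coeff_sub, coeff_smul, coeff_tor, smul_eq_mul, sub_self]

theorem exists_wt {n : ℕ} (g h : Submodule ℝ (VectPol n))
    (ht : ∀ i, ∀ Y ∈ h, vbracket (Pi.single i (X i)) Y ∈ h) :
    ∀ (N : ℕ) (Y : VectPol n), ∑ k, (Y k).support.card = N → Y ∈ h → Y ∉ g →
      ∃ Z ∈ h, Z ∉ g ∧ IsWt Z := by
  intro N
  induction N using Nat.strong_induction_on with
  | _ N ih =>
    intro Y hN hY hg
    by_cases hw : IsWt Y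
    · exact ⟨Y, hY, hg, hw⟩
    unfold IsWt at hw
    push Not at hw
    obtain ⟨j, k, a, b, ha, hb, i, hi⟩ := hw
    have h1 := size_lt Y i j a ha
    have h2 := size_lt Y i k b hb
    by_cases g1 : (vbracket (Pi.single i (X i)) Y - ((a i : ℝ) - if j = i then 1 else 0) • Y) ∈ g
    · by_cases g2 : (vbracket (Pi.single i (X i)) Y - ((b i : ℝ) - if k = i then 1 else 0) • Y) ∈ g
      · exfalso
        have := g.sub_mem g2 g1
        rw [sub_sub_sub_cancel_left, ← sub_smul] at this
        exact hg ((g.smul_mem_iff (sub_ne_zero.2 hi)).1 this)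
      · exact ih _ (hN ▸ h2) _ rfl (h.sub_mem (ht i Y hY) (h.smul_mem _ hY)) g2
    · exact ih _ (hN ▸ h1) _ rfl (h.sub_mem (ht i Y hY) (h.smul_mem _ hY)) g1

theorem wt_form {n : ℕ} (Y : VectPol n) (hw : IsWt Y) (h0 : Y ≠ 0) :
    (∃ (j : Fin n) (a : Fin n →₀ ℕ) (r : ℝ), r ≠ 0 ∧ a j = 0 ∧ Y = Pi.single j (monomial a r)) ∨
    (∃ (c : Fin n → ℝ) (m : Fin n →₀ ℕ), Y = DD c (monomial m 1)) := by
  have : ∃ j a, coeff a (Y j) ≠ 0 := by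
    by_contra hc
    push Not at hc
    apply h0
    funext j
    ext a
    simp [hc]
  obtain ⟨j, a, ha⟩ := this
  by_cases hj : a j = 0
  · left
    refine ⟨j, a, coeff a (Y j), ha, hj, ?_⟩
    have key : ∀ k b, coeff b (Y k) ≠ 0 → k = j ∧ b = a := by
      intro k b hb
      have h1 := hw j k a b ha hb
      have hk : k = j := by
        by_contra hne
        have := h1 j
        simp [hj, hne] at this
        have h3 : (0:ℝ) ≤ b j := by positivity
        linarith
      refine ⟨hk, ?_⟩
      subst hk
      ext i
      have := h1 i
      have h3 : (a i : ℝ) = b i := by linarith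
      exact_mod_cast h3.symm
    funext k
    ext b
    by_cases hb : coeff b (Y k) = 0
    · rw [hb]
      by_cases hk : k = j
      · subst hk
        rw [Pi.single_eq_same, coeff_monomial]
        split_ifs with hab
        · subst hab; exact hb.symm
        · rfl
      · simp [hk]
    · obtain ⟨rfl, rfl⟩ := key k b hb
      simp
  · right
    refine ⟨fun k => coeff (a - Finsupp.single j 1 + Finsupp.single k 1) (Y k), a - Finsupp.single j 1, ?_⟩
    funext k
    have hD : DD (fun k => coeff (a - Finsupp.single j 1 + Finsupp.single k 1) (Y k)) (monomial (a - Finsupp.single j 1) 1) k = monomial (a - Finsupp.single j 1 + Finsupp.single k 1) (coeff (a - Finsupp.single j 1 + Finsupp.single k 1) (Y k)) := by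
      simp only [DD]
      rw [mul_assoc, X, monomial_mul, C_mul_monomial, add_comm]
      simp
    rw [hD]
    ext b
    rw [coeff_monomial]
    split_ifs with hab
    · rw [hab]
    · by_contra hb
      apply hab
      have h1 := hw j k a b ha hb
      ext i
      have := h1 i
      have h3 : (a i : ℝ) + (if k = i then 1 else 0) = b i + (if j = i then 1 else 0) := by linarith
      have h4 : a i + (if k = i then 1 else 0) = b i + (if j = i then 1 else 0) := by exact_mod_cast h3
      simp only [Finsupp.add_apply, Finsupp.tsub_apply, Finsupp.single_apply]
      by_cases hji : j = i
      · subst hji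
        simp at h4 ⊢
        omega
      · simp [hji] at h4 ⊢
        omega

structure Adm {n : ℕ} (h : Submodule ℝ (VectPol n)) : Prop where
  hd : ∀ i, (Pi.single i 1 : VectPol n) ∈ h
  hx : ∀ a b, (Pi.single b (X a) : VectPol n) ∈ h
  hE : ∀ i, (fun k => X i * X k : VectPol n) ∈ h
  hbr : ∀ Xv ∈ h, ∀ Yv ∈ h, vbracket Xv Yv ∈ h

theorem of_comb {n : ℕ} {h : Submodule ℝ (VectPol n)} {V A B : VectPol n} (r : ℝ) (hr : r ≠ 0)
    (hV : V ∈ h) (hB : B ∈ h) (e : V = r • A + B) : A ∈ h := by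
  have : r • A ∈ h := by
    have := h.sub_mem hV hB
    rwa [e, add_sub_cancel_right] at this
  exact (h.smul_mem_iff hr).1 this

theorem sc {n : ℕ} {h : Submodule ℝ (VectPol n)} {b : Fin n} {f g : MvPolynomial (Fin n) ℝ}
    (r : ℝ) (hr : r ≠ 0) (hf : (Pi.single b g : VectPol n) ∈ h) (e : g = C r * f) :
    (Pi.single b f : VectPol n) ∈ h := by
  refine of_comb r hr hf h.zero_mem ?_
  rw [e, ← smul_eq_C_mul, add_zero, Pi.single_smul]

theorem mv {n : ℕ} {h : Submodule ℝ (VectPol n)} (A : Adm h) {b : Fin n}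
    {f : MvPolynomial (Fin n) ℝ} (i j : Fin n) (hjb : j ≠ b) (hf : (Pi.single b f : VectPol n) ∈ h) :
    (Pi.single b (X j * pderiv i f) : VectPol n) ∈ h := by
  have := A.hbr _ (A.hx j i) _ hf
  rw [br_ss, pderiv_X_of_ne hjb] at this
  simpa using this

theorem low {n : ℕ} {h : Submodule ℝ (VectPol n)} (A : Adm h) {b : Fin n}
    {f : MvPolynomial (Fin n) ℝ} (i : Fin n) (hf : (Pi.single b f : VectPol n) ∈ h) :
    (Pi.single b (pderiv i f) : VectPol n) ∈ h := by
  have := A.hbr _ (A.hd i) _ hf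
  rw [br_ss] at this
  simpa using this

theorem mvb {n : ℕ} {h : Submodule ℝ (VectPol n)} (A : Adm h) {b : Fin n}
    {f : MvPolynomial (Fin n) ℝ} (c : Fin n) (hc : pderiv c f = 0)
    (hf : (Pi.single b f : VectPol n) ∈ h) :
    (Pi.single c f : VectPol n) ∈ h := by
  have := A.hbr _ (A.hx b c) _ hf
  rw [br_ss, hc, pderiv_X_self] at this
  simpa using this

theorem quadA {n : ℕ} {h : Submodule ℝ (VectPol n)} (A : Adm h) {i b j : Fin n} (hjb : j ≠ b)
    (hp : (Pi.single b (X i * X i) : VectPol n) ∈ h) :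
    (Pi.single b (X i * X j) : VectPol n) ∈ h := by
  refine sc 2 two_ne_zero (mv A i j hjb hp) ?_
  rw [Derivation.leibniz, pderiv_X_self]
  simp only [smul_eq_mul, map_ofNat]
  ring

theorem quadB {n : ℕ} {h : Submodule ℝ (VectPol n)} (A : Adm h) {i b j : Fin n} (hjb : j ≠ b)
    (hp : (Pi.single b (X i * X i) : VectPol n) ∈ h) :
    (Pi.single b (X j * X j) : VectPol n) ∈ h := by
  by_cases hij : j = i
  · subst hij; exact hp
  have := mv A i j hjb (quadA A hjb hp)
  rw [Derivation.leibniz, pderiv_X_self, pderiv_X_of_ne hij] at this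
  simpa using this

theorem quadZ {n : ℕ} {h : Submodule ℝ (VectPol n)} (A : Adm h) {i b : Fin n} (hib : i ≠ b)
    (hp : (Pi.single b (X i * X i) : VectPol n) ∈ h) :
    (Pi.single b (2 * X i * X b) - Pi.single i (X i * X i) : VectPol n) ∈ h := by
  have := A.hbr _ (A.hx b i) _ hp
  rw [br_ss, Derivation.leibniz, pderiv_X_self, pderiv_X_self] at this
  convert this using 3
  · simp only [smul_eq_mul]; ring
  · simp

theorem br_add_right {n : ℕ} (U V W : VectPol n) :
    vbracket U (V - W) = vbracket U V - vbracket U W := by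
  funext k
  simp only [vbracket, Pi.sub_apply, map_sub, ← Finset.sum_sub_distrib]
  exact Finset.sum_congr rfl fun i _ => by ring

theorem quadSwap {n : ℕ} {h : Submodule ℝ (VectPol n)} (A : Adm h) {i b : Fin n} (hib : i ≠ b)
    (hp : (Pi.single b (X i * X i) : VectPol n) ∈ h) :
    (Pi.single i (X b * X b) : VectPol n) ∈ h := by
  have h1 := A.hbr _ (A.hx b i) _ (quadZ A hib hp)
  have h2 := A.hbr _ (A.hx b i) _ h1
  refine of_comb (-6) (by norm_num) h2 h.zero_mem ?_
  funext k
  have e2 : pderiv i (2 : MvPolynomial (Fin n) ℝ) = 0 := by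
    rw [← map_ofNat (C : ℝ →+* MvPolynomial (Fin n) ℝ) 2, pderiv_C]
  have e3 : pderiv b (2 : MvPolynomial (Fin n) ℝ) = 0 := by
    rw [← map_ofNat (C : ℝ →+* MvPolynomial (Fin n) ℝ) 2, pderiv_C]
  simp only [br_X, Pi.sub_apply, Pi.add_apply, Pi.smul_apply, Pi.single_apply, Pi.zero_apply,
    smul_eq_C_mul]
  have hbi := hib.symm
  by_cases hk : k = i
  · subst hk
    simp [hib, hbi, Derivation.leibniz, e2]
    rw [map_ofNat C 6]
    ring
  · by_cases hk' : k = b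
    · subst hk'
      simp [hib, hbi, Derivation.leibniz, pderiv_X_of_ne, e2, e3]
    · simp [hk, hk', Derivation.leibniz]

theorem quad_sq {n : ℕ} {h : Submodule ℝ (VectPol n)} (A : Adm h) {i b : Fin n} (hib : i ≠ b)
    (hp : (Pi.single b (X i * X i) : VectPol n) ∈ h) (p q : Fin n) (hpq : p ≠ q) :
    (Pi.single q (X p * X p) : VectPol n) ∈ h := by
  have hz : pderiv q (X p * X p : MvPolynomial (Fin n) ℝ) = 0 := by
    rw [Derivation.leibniz, pderiv_X_of_ne hpq]; simp
  by_cases hpb : p = b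
  · subst hpb
    exact mvb A q hz (quadSwap A hib hp)
  · exact mvb A q hz (quadB A hpb hp)

theorem quad_all {n : ℕ} {h : Submodule ℝ (VectPol n)} (A : Adm h) {i b : Fin n} (hib : i ≠ b)
    (hp : (Pi.single b (X i * X i) : VectPol n) ∈ h) (p q l : Fin n) :
    (Pi.single l (X p * X q) : VectPol n) ∈ h := by
  have hsq := quad_sq A hib hp
  have hdiag : ∀ p : Fin n, (Pi.single p (X p * X p) : VectPol n) ∈ h := by
    intro p
    have hS : ∑ b ∈ Finset.univ.erase p,
      (Pi.single b (2 * X p * X b) - Pi.single p (X p * X p) : VectPol n) ∈ h := by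
      refine h.sum_mem fun b hb => ?_
      have hb' := (Finset.ne_of_mem_erase hb).symm
      exact quadZ A hb' (hsq p b hb')
    have hn : 1 ≤ n := by have := p.2; omega
    refine of_comb ((n : ℝ) + 1) (by positivity) (h.smul_mem (2 : ℝ) (A.hE p)) hS ?_
    rw [Finset.sum_sub_distrib, Finset.sum_const, Finset.card_erase_of_mem (Finset.mem_univ _)]
    have e1 : ∑ b ∈ Finset.univ.erase p, (Pi.single b (2 * X p * X b) : VectPol n) =
      (fun k => 2 * X p * X k) - Pi.single p (2 * X p * X p) := by
      rw [eq_sub_iff_add_eq, Finset.sum_erase_add _ _ (Finset.mem_univ p)]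
      exact Finset.univ_sum_single (fun k => (2 * X p * X k : MvPolynomial (Fin n) ℝ))
    rw [e1, Finset.card_univ, Fintype.card_fin]
    funext k
    simp only [Pi.smul_apply, Pi.add_apply, Pi.sub_apply, Pi.single_apply, smul_eq_C_mul,
      nsmul_eq_mul]
    rw [Pi.mul_apply]
    simp only [Pi.natCast_apply, Nat.cast_sub hn, Pi.single_apply]
    split_ifs with hk
    · subst hk; simp only [map_add, map_natCast, map_one, map_ofNat]; push_cast; ring
    · simp only [map_ofNat, mul_zero, sub_zero]; ring
  have hmix : ∀ p l : Fin n, p ≠ l → (Pi.single l (X p * X l) : VectPol n) ∈ h := by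
    intro p l hpl
    refine of_comb 2 two_ne_zero (quadZ A hpl (hsq p l hpl)) (h.neg_mem (hdiag p)) ?_
    rw [← Pi.single_smul, smul_eq_C_mul, sub_eq_add_neg, mul_assoc, map_ofNat]
  by_cases hpl : p = l
  · subst hpl
    by_cases hq : q = p
    · subst hq; exact hdiag q
    · rw [mul_comm]; exact hmix _ _ hq
  · by_cases hq : q = l
    · subst hq; exact hmix _ _ hpl
    · exact quadA A hq (hsq p l hpl)

theorem br_E {n : ℕ} (i l : Fin n) (f : MvPolynomial (Fin n) ℝ) (d : ℕ) (hf : f.IsHomogeneous d) :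
    vbracket (fun k => X i * X k : VectPol n) (Pi.single l f) =
      Pi.single l (C ((d : ℝ) - 1) * (X i * f)) - if i = l then (fun k => X k * f) else 0 := by
  funext k
  have h1 : ∑ m, X i * X m * pderiv m f = X i * ((d : MvPolynomial (Fin n) ℝ) * f) := by
    rw [← nsmul_eq_mul, ← hf.sum_X_mul_pderiv, Finset.mul_sum]
    simp only [mul_assoc]
  simp only [vbracket, Finset.sum_sub_distrib, Pi.sub_apply, Pi.single_apply]
  have h2 : ∑ m, (if m = l then f else 0) * pderiv m (X i * X k) = f * pderiv l (X i * X k) := by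
    simp
  rw [h2, Derivation.leibniz]
  simp only [smul_eq_mul, pderiv_X, Pi.single_apply]
  by_cases hk : k = l
  · subst hk
    simp only [if_true, h1]
    split_ifs <;> simp <;> ring
  · simp only [hk, if_false]
    split_ifs <;> simp [mul_comm]

def HH {n : ℕ} (h : Submodule ℝ (VectPol n)) (d : ℕ) : Prop :=
  ∀ a : Fin n →₀ ℕ, a.degree = d → ∀ l, (Pi.single l (monomial a 1) : VectPol n) ∈ h

theorem HH_step {n : ℕ} {h : Submodule ℝ (VectPol n)} (A : Adm h) (hn : 2 ≤ n) (d : ℕ)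
    (hd : 2 ≤ d) (H : HH h d) : HH h (d + 1) := by
  have hdr : (d : ℝ) - 1 ≠ 0 := by
    have : (2 : ℝ) ≤ d := by exact_mod_cast hd
    intro h; linarith
  have key : ∀ (b : Fin n →₀ ℕ) (i l : Fin n), b.degree = d → i ≠ l →
      (Pi.single l (X i * monomial b 1) : VectPol n) ∈ h := by
    intro b i l hb hil
    have := A.hbr _ (A.hE i) _ (H b hb l)
    rw [br_E i l _ d (isHomogeneous_monomial _ hb), if_neg hil, sub_zero] at this
    exact sc _ hdr this rfl
  intro a ha l
  by_cases hex : ∃ i, i ≠ l ∧ a i ≠ 0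
  · obtain ⟨i, hil, hai⟩ := hex
    have hle : Finsupp.single i 1 ≤ a := by
      rw [Finsupp.single_le_iff]; omega
    have e : a = Finsupp.single i 1 + (a - Finsupp.single i 1) := (add_tsub_cancel_of_le hle).symm
    have := key (a - Finsupp.single i 1) i l (by
      rw [e, map_add, Finsupp.degree_single] at ha; omega) hil
    rw [X, monomial_mul, one_mul, ← e] at this
    exact this
  · push Not at hex
    have e : a = Finsupp.single l (d + 1) := by
      have : a = Finsupp.single l (a l) := by
        ext i
        by_cases hi : i = l
        · subst hi; simp
        · simp [hex i hi, Ne.symm hi]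
      rw [this, Finsupp.degree_single] at ha
      rw [this, ha]
    haveI : Nontrivial (Fin n) := Fin.nontrivial_iff_two_le.2 hn
    obtain ⟨i, hi⟩ := exists_ne l
    have h1 := key (Finsupp.single l d) i l (by simp) hi
    have h2 : (Pi.single i (X l * monomial (Finsupp.single l d) 1) : VectPol n) ∈ h :=
      key (Finsupp.single l d) l i (by simp) hi.symm
    have h3 := A.hbr _ (A.hx l i) _ h1
    rw [br_ss, pderiv_X_self, Derivation.leibniz, pderiv_X_self, pderiv_monomial] at h3
    have hz : (Finsupp.single l d : Fin n →₀ ℕ) i = 0 := by simp [hi.symm]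
    rw [hz] at h3
    have h4 := key (Finsupp.single l (d - 1) + Finsupp.single i 1) l i (by
      rw [map_add, Finsupp.degree_single, Finsupp.degree_single]; omega) hi.symm
    have e4 : (X l * monomial (Finsupp.single l (d - 1) + Finsupp.single i 1) 1 :
        MvPolynomial (Fin n) ℝ) = X i * monomial (Finsupp.single l d) 1 := by
      rw [X, X, monomial_mul, monomial_mul, ← add_assoc, ← Finsupp.single_add, add_comm,
        show 1 + (d - 1) = d by omega]
    rw [e4] at h4
    refine of_comb 1 one_ne_zero h3 (h.neg_mem h4) ?_
    have e5 : (X l * monomial (Finsupp.single l d) 1 : MvPolynomial (Fin n) ℝ) = monomial a 1 := by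
      rw [X, monomial_mul, ← Finsupp.single_add, e, add_comm 1 d, one_mul]
    rw [one_smul, ← e5, sub_eq_add_neg]
    simp

theorem HH_top {n : ℕ} {h : Submodule ℝ (VectPol n)} (H : ∀ d, HH h d) : h = ⊤ := by
  rw [eq_top_iff]
  intro Y _
  rw [← Finset.univ_sum_single Y]
  refine h.sum_mem fun l _ => ?_
  induction Y l using MvPolynomial.induction_on' with
  | monomial u r =>
    have := h.smul_mem r (H _ u rfl l)
    rw [← Pi.single_smul, smul_monomial, smul_eq_mul, mul_one] at this
    exact this
  | add p q hp hq =>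
    rw [Pi.single_add]
    exact h.add_mem hp hq

theorem deg_one {n : ℕ} (a : Fin n →₀ ℕ) (d : ℕ) (ha : a.degree = d + 1) :
    ∃ i b, a = Finsupp.single i 1 + b ∧ b.degree = d := by
  have h0 : a ≠ 0 := by
    rintro rfl
    simp at ha
  obtain ⟨i, hi⟩ := Finsupp.ne_iff.1 h0
  have hle : Finsupp.single i 1 ≤ a := by
    rw [Finsupp.single_le_iff]
    simp at hi
    omega
  have e : a = Finsupp.single i 1 + (a - Finsupp.single i 1) := (add_tsub_cancel_of_le hle).symm
  refine ⟨i, _, e, ?_⟩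
  rw [e, map_add, Finsupp.degree_single] at ha
  omega

theorem HH_zero {n : ℕ} {h : Submodule ℝ (VectPol n)} (A : Adm h) : HH h 0 := by
  intro a ha l
  rw [Finsupp.degree_eq_zero_iff] at ha
  subst ha
  exact A.hd l

theorem HH_one {n : ℕ} {h : Submodule ℝ (VectPol n)} (A : Adm h) : HH h 1 := by
  intro a ha l
  obtain ⟨i, b, rfl, hb⟩ := deg_one a 0 ha
  rw [Finsupp.degree_eq_zero_iff] at hb
  subst hb
  rw [add_zero]
  exact A.hx i l

/-- n ≥ 2 : one square suffices -/
theorem top_of_quad {n : ℕ} {h : Submodule ℝ (VectPol n)} (A : Adm h) (hn : 2 ≤ n) {i b : Fin n}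
    (hib : i ≠ b) (hp : (Pi.single b (X i * X i) : VectPol n) ∈ h) : h = ⊤ := by
  have H2 : HH h 2 := by
    intro a ha l
    obtain ⟨i', b', rfl, hb⟩ := deg_one a 1 ha
    obtain ⟨j', c', rfl, hc⟩ := deg_one b' 0 hb
    rw [Finsupp.degree_eq_zero_iff] at hc
    subst hc
    have := quad_all A hib hp i' j' l
    rw [X, X, monomial_mul, one_mul] at this
    simpa using this
  apply HH_top
  intro d
  rcases d with _ | _ | d
  · exact HH_zero A
  · exact HH_one A
  · induction d with
    | zero => exact H2
    | succ d ih => exact HH_step A hn _ (by omega) ih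

/-- case 1 -/
theorem top_of_mon {n : ℕ} {h : Submodule ℝ (VectPol n)} (A : Adm h) (hn : 2 ≤ n) (j : Fin n)
    (d : ℕ) : ∀ (a : Fin n →₀ ℕ), a.degree = d + 2 → a j = 0 →
    (Pi.single j (monomial a 1) : VectPol n) ∈ h → h = ⊤ := by
  induction d with
  | zero =>
    intro a ha hj hm
    obtain ⟨i, b', rfl, hb⟩ := deg_one a 1 ha
    obtain ⟨k, c', rfl, hc⟩ := deg_one b' 0 hb
    rw [Finsupp.degree_eq_zero_iff] at hc
    subst hc
    have hij : i ≠ j := by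
      rintro rfl; simp at hj
    have e : (monomial (Finsupp.single i 1 + (Finsupp.single k 1 + 0)) 1 : MvPolynomial (Fin n) ℝ)
        = X i * X k := by
      rw [X, X, monomial_mul, one_mul, add_zero]
    rw [e] at hm
    by_cases hik : i = k
    · subst hik
      exact top_of_quad A hn hij hm
    · have := mv A k i hij hm
      rw [Derivation.leibniz, pderiv_X_self, pderiv_X_of_ne hik] at this
      simp only [smul_eq_mul, mul_one, mul_zero, add_zero] at this
      exact top_of_quad A hn hij this
  | succ d ih =>
    intro a ha hj hm
    obtain ⟨i, b, rfl, hb⟩ := deg_one a (d + 2) ha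
    have hbj : b j = 0 := by
      simp at hj; exact hj.2
    refine ih b hb hbj ?_
    have := low A i hm
    rw [pderiv_monomial, add_tsub_cancel_left] at this
    refine sc ((b i : ℝ) + 1) (by positivity) this ?_
    rw [C_mul_monomial]
    simp [add_comm]

theorem D_mem {n : ℕ} {h : Submodule ℝ (VectPol n)} (A : Adm h) (a b : Fin n) (hab : a ≠ b)
    (Q : MvPolynomial (Fin n) ℝ) (hQ : pderiv b Q = 0) (m : ℕ) : ∀ (c : Fin n → ℝ) (s : ℕ),
    c a ≠ c b → DD c (X b ^ m * (X a ^ s * Q)) ∈ h →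
      (Pi.single b (X a ^ (s + m + 1) * Q) : VectPol n) ∈ h := by
  have hD : ∀ (c : Fin n → ℝ) P, DD c P ∈ h →
      DD c (X a * pderiv b P) + (Pi.single b (C (c b - c a) * X a * P) : VectPol n) ∈ h := by
    intro c P hP
    have := A.hbr _ (A.hx a b) _ hP
    convert this using 1
    funext k
    rw [br_X]
    simp only [DD, Pi.add_apply, Pi.single_apply, Derivation.leibniz, pderiv_C, pderiv_X,
      smul_eq_mul]
    by_cases hk : k = b
    · subst hk; simp; ring
    · simp [hk]; ring
  have hQ' : ∀ s : ℕ, pderiv b (X a ^ s * Q) = 0 := by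
    intro s
    rw [Derivation.leibniz, hQ, Derivation.leibniz_pow, pderiv_X_of_ne hab]
    simp
  clear hQ
  induction m with
  | zero =>
    intro c s hc hm
    have := hD c _ hm
    rw [pow_zero, one_mul, hQ'] at this
    refine sc (c b - c a) (sub_ne_zero.2 hc.symm) (g := C (c b - c a) * X a * (X a ^ s * Q)) ?_ ?_
    · convert this using 1
      funext k
      simp [DD]
    · ring
  | succ m ih =>
    intro c s hc hm
    have := hD c _ hm
    have h2 := ih (fun k : Fin n => ((m : ℝ) + 1) * c k + if k = b then c b - c a else 0) (s + 1) (by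
      simp only [hab, if_false, if_true]
      intro h
      apply hc
      have : ((m : ℝ) + 2) * (c a - c b) = 0 := by linarith
      rcases mul_eq_zero.1 this with h | h
      · have : (0:ℝ) ≤ m := by positivity
        linarith
      · linarith) (by
      convert this using 1
      funext k
      rw [Derivation.leibniz, hQ', Derivation.leibniz_pow, pderiv_X_self]
      simp only [DD, Pi.add_apply, Pi.single_apply]
      by_cases hk : k = b
      · subst hk; simp; ring
      · simp [hk]; ring)
    rw [show s + (m + 1) + 1 = s + 1 + m + 1 by ring]
    exact h2

theorem mon_split {n : ℕ} (m : Fin n →₀ ℕ) (b : Fin n) :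
    (monomial m 1 : MvPolynomial (Fin n) ℝ) = X b ^ (m b) * monomial (m.erase b) 1 := by
  rw [X_pow_eq_monomial, monomial_mul, one_mul, Finsupp.single_add_erase]

theorem top_of_D {n : ℕ} {h : Submodule ℝ (VectPol n)} (A : Adm h) (a b : Fin n)
    (c : Fin n → ℝ) (hc : c a ≠ c b) (m : Fin n →₀ ℕ) (hm : m ≠ 0)
    (hD : DD c (monomial m 1) ∈ h) : h = ⊤ := by
  have hab : a ≠ b := by rintro rfl; exact hc rfl
  have hn : 2 ≤ n := by
    have h1 := a.2
    have h2 := b.2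
    have h3 : a.1 ≠ b.1 := fun h => hab (Fin.ext h)
    omega
  have hQ : pderiv b (monomial (m.erase b) 1 : MvPolynomial (Fin n) ℝ) = 0 := by
    rw [pderiv_monomial]; simp
  have h1 := D_mem A a b hab (monomial (m.erase b) 1) hQ (m b) c 0 hc (by
    rw [pow_zero, one_mul, ← mon_split]; exact hD)
  rw [X_pow_eq_monomial, monomial_mul, one_mul] at h1
  have hd : (Finsupp.single b (m b) + m.erase b).degree ≠ 0 := by
    rw [Finsupp.single_add_erase, Ne, Finsupp.degree_eq_zero_iff]; exact hm
  rw [map_add, Finsupp.degree_single] at hd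
  refine top_of_mon A hn b (m b + (m.erase b).degree - 1) _ ?_ ?_ h1
  · rw [map_add, Finsupp.degree_single]; omega
  · simp [hab]

theorem top_of_E {n : ℕ} {h : Submodule ℝ (VectPol n)} (A : Adm h) (hn : 2 ≤ n)
    (m : Fin n →₀ ℕ) (hm : 2 ≤ m.degree)
    (hD : DD (fun _ => 1) (monomial m 1) ∈ h) : h = ⊤ := by
  obtain ⟨i, p, rfl, hp⟩ := deg_one m (m.degree - 1) (by omega)
  have : Nontrivial (Fin n) := Fin.nontrivial_iff_two_le.2 hn
  obtain ⟨k, hk⟩ := exists_ne i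
  refine top_of_D A i k (fun k => (p i + 1) + if k = i then 1 else 0) (by simp [hk]) p ?_ ?_
  · rintro rfl
    simp at hm
  · have := A.hbr _ (A.hd i) _ hD
    convert this using 1
    funext k
    rw [br_one]
    have e : (monomial (Finsupp.single i 1 + p) 1 : MvPolynomial (Fin n) ℝ)
        = X i * monomial p 1 := by rw [X, monomial_mul, one_mul]
    have e2 : pderiv i (monomial (Finsupp.single i 1 + p) 1 : MvPolynomial (Fin n) ℝ)
        = C ((p i : ℝ) + 1) * monomial p 1 := by
      rw [pderiv_monomial, add_tsub_cancel_left, C_mul_monomial]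
      simp [add_comm]
    simp only [DD, map_one, one_mul]
    rw [Derivation.leibniz, e2, e, pderiv_X, Pi.single_apply]
    by_cases hk : k = i
    · subst hk; simp; ring
    · simp [hk, Ne.symm hk]; ring

theorem top_one {h : Submodule ℝ (VectPol 1)} (A : Adm h) (d : ℕ) (hd : 3 ≤ d)
    (hm : (Pi.single 0 (X 0 ^ d) : VectPol 1) ∈ h) : h = ⊤ := by
  have hup : ∀ k, (Pi.single 0 (X 0 ^ (d + k)) : VectPol 1) ∈ h := by
    intro k
    induction k with
    | zero => exact hm
    | succ k ih =>
      have h2 : (Pi.single 0 (X 0 * X 0) : VectPol 1) ∈ h := by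
        convert A.hE 0 using 1
        funext j
        fin_cases j
        simp
      have := A.hbr _ h2 _ ih
      rw [br_ss, Derivation.leibniz, Derivation.leibniz_pow, pderiv_X_self, ← Pi.single_sub] at this
      refine sc ((d : ℝ) + k - 2) ?_ this ?_
      · have h3 : (3 : ℝ) ≤ d := by exact_mod_cast hd
        have h4 : (0 : ℝ) ≤ k := by positivity
        intro h; linarith
      · obtain ⟨e, rfl⟩ : ∃ e, d = e + 1 := ⟨d - 1, by omega⟩
        rw [show e + 1 + k - 1 = e + k by omega]
        simp only [smul_eq_mul, nsmul_eq_mul, map_sub, map_add, map_natCast, map_ofNat]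
        push_cast
        ring
  have hdown : ∀ k e, (Pi.single 0 (X 0 ^ (e + k)) : VectPol 1) ∈ h →
      (Pi.single 0 (X 0 ^ e) : VectPol 1) ∈ h := by
    intro k
    induction k with
    | zero => intro e he; exact he
    | succ k ih =>
      intro e he
      apply ih
      have := low A 0 he
      rw [Derivation.leibniz_pow, pderiv_X_self] at this
      refine sc ((e : ℝ) + k + 1) (by positivity) this ?_
      rw [show e + (k + 1) - 1 = e + k by omega]
      simp only [smul_eq_mul, nsmul_eq_mul, map_add, map_natCast, map_one]
      push_cast
      ring
  apply HH_top
  intro e a ha l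
  have hl : l = 0 := Subsingleton.elim _ _
  subst hl
  have : (monomial a 1 : MvPolynomial (Fin 1) ℝ) = X 0 ^ (a 0) := by
    rw [X_pow_eq_monomial]
    have e : a = Finsupp.single 0 (a 0) := by
      refine Finsupp.ext fun i => ?_
      have hi : i = 0 := Subsingleton.elim _ _
      subst hi
      simp
    rw [← e]
  rw [this]
  apply hdown d
  rw [add_comm]
  exact hup _

theorem top_of_wt {n : ℕ} (hn : 1 ≤ n) {h : Submodule ℝ (VectPol n)} (A : Adm h)
    (g : Submodule ℝ (VectPol n)) (G : ∀ i, (Pi.single i 1 : VectPol n) ∈ g)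
    (Gx : ∀ a b, (Pi.single b (X a) : VectPol n) ∈ g)
    (GE : ∀ i, (fun k => X i * X k : VectPol n) ∈ g)
    (Z : VectPol n) (hZ : Z ∈ h) (hg : Z ∉ g) (hw : IsWt Z) : h = ⊤ := by
  have h0 : Z ≠ 0 := by rintro rfl; exact hg g.zero_mem
  rcases wt_form Z hw h0 with ⟨j, a, r, hr, haj, rfl⟩ | ⟨c, m, rfl⟩
  · have hr1 : (Pi.single j (monomial a r) : VectPol n) = r • Pi.single j (monomial a 1) := by
      rw [← Pi.single_smul, smul_monomial]; simp
    rw [hr1] at hZ hg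
    have hZ' := (h.smul_mem_iff hr).1 hZ
    have hg' : (Pi.single j (monomial a 1) : VectPol n) ∉ g := fun hh => hg (g.smul_mem _ hh)
    have hd : 2 ≤ a.degree := by
      by_contra hlt
      have : a.degree = 0 ∨ a.degree = 0 + 1 := by omega
      rcases this with h1 | h1
      · rw [Finsupp.degree_eq_zero_iff] at h1
        subst h1
        exact hg' (G j)
      · obtain ⟨i, b, rfl, hb⟩ := deg_one a 0 h1
        rw [Finsupp.degree_eq_zero_iff] at hb
        subst hb
        rw [add_zero] at hg'
        exact hg' (Gx i j)
    have hn2 : 2 ≤ n := by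
      obtain ⟨i, b, rfl, hb⟩ := deg_one a (a.degree - 1) (by omega)
      have hij : i ≠ j := by
        rintro rfl; simp at haj
      have h1 := i.2
      have h2 := j.2
      have h3 : i.1 ≠ j.1 := fun h => hij (Fin.ext h)
      omega
    exact top_of_mon A hn2 j (a.degree - 2) a (by omega) haj hZ'
  · have hE0 : DD c (monomial 0 1) ∈ g := by
      rw [← Finset.univ_sum_single (DD c (monomial 0 1))]
      refine g.sum_mem fun k _ => ?_
      have := g.smul_mem (c k) (Gx k k)
      rw [← Pi.single_smul, smul_eq_C_mul] at this
      simpa [DD] using this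
    have hm0 : m ≠ 0 := by rintro rfl; exact hg hE0
    by_cases hc : ∃ a b, c a ≠ c b
    · obtain ⟨a, b, hab⟩ := hc
      exact top_of_D A a b c hab m hm0 hZ
    · push Not at hc
      set r := c ⟨0, hn⟩ with hrdef
      have hs : DD c (monomial m 1) = r • DD (fun _ => 1) (monomial m 1) := by
        funext k
        simp only [DD, Pi.smul_apply, smul_eq_C_mul, map_one, one_mul]
        rw [hc k ⟨0, hn⟩, mul_assoc]
      rw [hs] at hZ hg h0
      have hr : r ≠ 0 := by
        intro h; rw [h, zero_smul] at h0; exact h0 rfl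
      have hZ' := (h.smul_mem_iff hr).1 hZ
      have hg' : DD (fun _ => 1) (monomial m 1) ∉ g := fun hh => hg (g.smul_mem _ hh)
      have hd : 2 ≤ m.degree := by
        by_contra hlt
        have h2 : m.degree ≠ 0 := by rwa [Ne, Finsupp.degree_eq_zero_iff]
        obtain ⟨i, b, rfl, hb⟩ := deg_one m 0 (by omega)
        rw [Finsupp.degree_eq_zero_iff] at hb
        subst hb
        apply hg'
        convert GE i using 1
        funext k
        simp only [DD, map_one, one_mul, add_zero]
        rw [mul_comm]
        rfl
      by_cases hn2 : 2 ≤ n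
      · exact top_of_E A hn2 m hd hZ'
      · obtain rfl : n = 1 := by omega
        have hmd : m = Finsupp.single 0 (m 0) := by
          refine Finsupp.ext fun i => ?_
          have hi : i = 0 := Subsingleton.elim _ _
          subst hi
          simp
        rw [hmd, Finsupp.degree_single] at hd
        refine top_one A (m 0 + 1) (by omega) ?_
        convert hZ' using 1
        funext k
        have hk : k = 0 := Subsingleton.elim _ _
        subst hk
        rw [hmd, ← X_pow_eq_monomial]
        simp [DD]
        ring

theorem stmt2 (n : ℕ) (hn : 1 ≤ n) (h : Submodule ℝ (VectPol n))
    (hbracket : ∀ Xv ∈ h, ∀ Yv ∈ h, vbracket Xv Yv ∈ h)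
    (hlt : Submodule.span ℝ (projGen n) < h) :
    h = ⊤ := by
  have G : ∀ i, (Pi.single i 1 : VectPol n) ∈ Submodule.span ℝ (projGen n) := by
    intro i
    apply Submodule.subset_span
    refine Or.inl (Or.inl ⟨i, ?_⟩)
    funext k
    simp [Pi.single_apply]
  have Gx : ∀ a b, (Pi.single b (X a) : VectPol n) ∈ Submodule.span ℝ (projGen n) := by
    intro a b
    apply Submodule.subset_span
    refine Or.inl (Or.inr ⟨(a, b), ?_⟩)
    funext k
    simp [Pi.single_apply]
  have GE : ∀ i, (fun k => X i * X k : VectPol n) ∈ Submodule.span ℝ (projGen n) := by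
    intro i
    apply Submodule.subset_span
    exact Or.inr ⟨i, rfl⟩
  have A : Adm h := ⟨fun i => hlt.le (G i), fun a b => hlt.le (Gx a b), fun i => hlt.le (GE i),
    hbracket⟩
  obtain ⟨Y, hY, hYg⟩ := SetLike.exists_of_lt hlt
  obtain ⟨Z, hZ, hZg, hw⟩ := exists_wt _ h (fun i Y hY => hbracket _ (A.hx i i) _ hY) _ Y rfl hY hYg
  exact top_of_wt hn A _ G Gx GE Z hZ hZg hw
end

section
/- Let p, q ≥ 0 with n = p + q ≥ 3, let η = diag(1, …, 1, −1, …, −1) be the flat metric of signature (p, q) on ℝ^n, and write x_i = η_{ij} x^j. Let g ⊂ Vect_Pol(ℝ^n) be the Lie subalgebra spanned by the vector fields ∂_i (1 ≤ i ≤ n), x_i ∂_j − x_j ∂_i (1 ≤ i < j ≤ n), E = x^j ∂_j, and x_j x^j ∂_i − 2 x_i E (1 ≤ i ≤ n) (a subalgebra isomorphic to o(p+1, q+1)). Then g is a maximal Lie subalgebra of Vect_Pol(ℝ^n): every Lie subalgebra h with g ⊊ h ⊆ Vect_Pol(ℝ^n) equals Vect_Pol(ℝ^n). -/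
set_option maxHeartbeats 1000000

open MvPolynomial

/-- The flat metric `η = diag(1, …, 1, −1, …, −1)` of signature `(p, q)`. -/
def etaSgn (p q : ℕ) : Fin (p + q) → ℝ := fun i => if (i : ℕ) < p then 1 else -1

/-- The conformal generators on `ℝⁿ`, `n = p + q`: translations `∂ᵢ`,
rotations `xᵢ∂ⱼ − xⱼ∂ᵢ`, the Euler field `E = xʲ∂ⱼ`, and the inversions
`xⱼxʲ∂ᵢ − 2xᵢE`, where `xᵢ = ηᵢⱼ xʲ`. -/
noncomputable def confGen (p q : ℕ) : Set (VectPol (p + q)) :=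
  (Set.range fun i : Fin (p + q) =>
    (fun k => if k = i then 1 else 0 : VectPol (p + q))) ∪
  (Set.range fun pr : Fin (p + q) × Fin (p + q) =>
    (fun k => (if k = pr.2 then C (etaSgn p q pr.1) * X pr.1 else 0)
      - (if k = pr.1 then C (etaSgn p q pr.2) * X pr.2 else 0) : VectPol (p + q))) ∪
  {(fun k => X k : VectPol (p + q))} ∪
  (Set.range fun i : Fin (p + q) =>
    (fun k => (if k = i then ∑ j, C (etaSgn p q j) * X j * X j else 0)
      - C 2 * C (etaSgn p q i) * X i * X k : VectPol (p + q)))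

set_option linter.unusedSimpArgs false

section
open Matrix

lemma ad_identity {n : ℕ} (R A : Matrix (Fin n) (Fin n) ℝ) (e : ℝ) (hR : R * R * R + e • R = 0)
    (L : Submodule ℝ (Matrix (Fin n) (Fin n) ℝ))
    (hL : ∀ A ∈ L, A * R - R * A ∈ L) (hA : A ∈ L) :
    R * R * A * (R * R) + e • (R * A * R) ∈ L := by
  have h1 := hL _ hA
  have h2 := hL _ h1
  have h3 := hL _ h2
  have h4 := hL _ h3
  have h5 := L.add_mem h4 (L.smul_mem e h2)
  have h6 := L.smul_mem (1/6 : ℝ) h5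
  convert h6 using 1
  have e1 : R * R * R = - (e • R) := eq_neg_of_add_eq_zero_left hR
  have : (((A * R - R * A) * R - R * (A * R - R * A)) * R - R * ((A * R - R * A) * R - R * (A * R - R * A))) * R - R * (((A * R - R * A) * R - R * (A * R - R * A)) * R - R * ((A * R - R * A) * R - R * (A * R - R * A)))
     = A * R * (R * R * R) - (4:ℝ) • (R * A * (R * R * R)) + (6:ℝ) • (R * R * A * (R * R)) - (4:ℝ) • ((R * R * R) * A * R) + (R * R * R) * (R * A) := by
    simp only [mul_add, mul_sub, sub_mul, mul_assoc]
    module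
  rw [this, e1]
  simp only [mul_add, mul_sub, sub_mul, mul_assoc, mul_neg, neg_mul, smul_mul_assoc, mul_smul_comm, smul_sub]
  module

variable {n : ℕ}

noncomputable def RM (η : Fin n → ℝ) (i j : Fin n) : Matrix (Fin n) (Fin n) ℝ :=
  η i • Matrix.single j i 1 - η j • Matrix.single i j 1
noncomputable def SM (η : Fin n → ℝ) (i j : Fin n) : Matrix (Fin n) (Fin n) ℝ :=
  Matrix.single i j 1 + (η i * η j) • Matrix.single j i 1

lemma sm (i j k l : Fin n) : (Matrix.single i j (1:ℝ) : Matrix (Fin n) (Fin n) ℝ) * Matrix.single k l 1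
    = if j = k then Matrix.single i l 1 else 0 := by
  split_ifs with h
  · subst h; simp
  · simp [h]

lemma sms (A : Matrix (Fin n) (Fin n) ℝ) (i j k l : Fin n) :
    (Matrix.single i j (1:ℝ) : Matrix (Fin n) (Fin n) ℝ) * (A * Matrix.single k l 1)
    = A j k • Matrix.single i l 1 := by
  rw [← mul_assoc, Matrix.single_mul_mul_single, Matrix.smul_single]; simp

lemma br_E_R (η : Fin n → ℝ) (hη : ∀ i, η i * η i = 1) (i k : Fin n) (h : i ≠ k) :
    single i i 1 * RM η i k - RM η i k * single i i 1 = - η k • SM η i k := by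
  have h1 := hη k
  have h2 := hη i
  simp only [RM, SM, mul_add, mul_sub, sub_mul, add_mul, smul_mul_assoc, mul_smul_comm, sm, h, h.symm, if_true, if_false]
  match_scalars <;> grind

lemma br_D_R (η : Fin n → ℝ) (hη : ∀ i, η i * η i = 1) (i k : Fin n) (h : i ≠ k) :
    (single i i 1 - single k k 1) * RM η i k - RM η i k * (single i i 1 - single k k 1) = (-2 * η k) • SM η i k := by
  have h1 := hη k
  have h2 := hη i
  simp only [RM, SM, mul_add, mul_sub, sub_mul, add_mul, smul_mul_assoc, mul_smul_comm, sm, h, h.symm, if_true, if_false]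
  match_scalars <;> grind

lemma br_S_R (η : Fin n → ℝ) (hη : ∀ i, η i * η i = 1) (i k : Fin n) (h : i ≠ k) :
    SM η i k * RM η i k - RM η i k * SM η i k = (2 * η i) • (single i i 1 - single k k 1) := by
  have h1 := hη k
  have h2 := hη i
  simp only [RM, SM, mul_add, mul_sub, sub_mul, add_mul, smul_mul_assoc, mul_smul_comm, sm, h, h.symm, if_true, if_false]
  match_scalars <;> grind

lemma br_S_R' (η : Fin n → ℝ) (hη : ∀ i, η i * η i = 1) (i j k : Fin n) (h : i ≠ k) (h' : i ≠ j) (h'' : j ≠ k) :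
    SM η i j * RM η i k - RM η i k * SM η i j = (- η i) • SM η k j := by
  have h1 := hη k
  have h2 := hη i
  simp only [RM, SM, mul_add, mul_sub, sub_mul, add_mul, smul_mul_assoc, mul_smul_comm, sm, h, h.symm, h', h'.symm, h'', h''.symm, if_true, if_false]
  match_scalars <;> grind

lemma RM_anti (η : Fin n → ℝ) (i k : Fin n) : RM η i k = - RM η k i := by
  simp [RM]

lemma br_S_R'' (η : Fin n → ℝ) (hη : ∀ i, η i * η i = 1) (i j k : Fin n) (h : i ≠ k) (h' : i ≠ j) (h'' : j ≠ k) :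
    SM η k j * RM η i k - RM η i k * SM η k j = (η k) • SM η i j := by
  have := br_S_R' η hη k j i h.symm h''.symm h'.symm
  rw [RM_anti η i k]
  calc _ = -(SM η k j * RM η k i - RM η k i * SM η k j) := by noncomm_ring
    _ = _ := by rw [this]; module

lemma RM_cube (η : Fin n → ℝ) (hη : ∀ i, η i * η i = 1) (i k : Fin n) (h : i ≠ k) :
    RM η i k * RM η i k * RM η i k + (η i * η k) • RM η i k = 0 := by
  have h1 := hη k
  have h2 := hη i
  simp only [RM, mul_add, mul_sub, sub_mul, add_mul, smul_mul_assoc, mul_smul_comm, sm, h, h.symm, if_true, if_false, ite_mul, zero_mul, smul_zero]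
  match_scalars <;> grind

lemma RM_proj (η : Fin n → ℝ) (hη : ∀ i, η i * η i = 1) (i j : Fin n) (h : i ≠ j) (A : Matrix (Fin n) (Fin n) ℝ) :
    RM η i j * RM η i j * A * (RM η i j * RM η i j) + (η i * η j) • (RM η i j * A * RM η i j)
     = (A i i - A j j) • (single i i 1 - single j j 1) + (A i j + η i * η j * A j i) • SM η i j := by
  have h1 := hη i
  have h2 := hη j
  have : RM η i j * RM η i j = (-(η i * η j)) • (single i i 1 + single j j 1) := by
    simp only [RM, mul_add, mul_sub, sub_mul, add_mul, smul_mul_assoc, mul_smul_comm, sm, h, h.symm, if_true, if_false]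
    match_scalars <;> grind
  rw [this]
  simp only [RM, SM, mul_assoc, mul_add, mul_sub, sub_mul, add_mul, smul_mul_assoc, mul_smul_comm, sms, h, h.symm, if_true, if_false]
  match_scalars <;> grind

theorem mat_top (hn : 3 ≤ n) (η : Fin n → ℝ) (hη : ∀ i, η i * η i = 1)
    (L : Submodule ℝ (Matrix (Fin n) (Fin n) ℝ))
    (hL : ∀ A ∈ L, ∀ B ∈ L, A * B - B * A ∈ L) (h1 : 1 ∈ L) (hR : ∀ i j, RM η i j ∈ L)
    (A : Matrix (Fin n) (Fin n) ℝ) (hA : A ∈ L) (i j : Fin n) (hij : i ≠ j)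
    (hA' : ¬ (A i i = A j j ∧ η j * A j i + η i * A i j = 0)) : L = ⊤ := by
  have hη0 : ∀ i, η i ≠ 0 := fun i h => by have := hη i; simp [h] at this
  have third : ∀ a b : Fin n, ∃ c, c ≠ a ∧ c ≠ b := by
    intro a b
    have : ({a, b} : Finset (Fin n)).card < (Finset.univ : Finset (Fin n)).card := by
      have := Finset.card_le_two (a := a) (b := b)
      simp; omega
    obtain ⟨c, -, hc⟩ := Finset.exists_mem_notMem_of_card_lt_card this
    simp at hc
    exact ⟨c, hc.1, hc.2⟩
  have hsm : ∀ (c : ℝ) (x : Matrix (Fin n) (Fin n) ℝ), c ≠ 0 → c • x ∈ L → x ∈ L := fun c x hc hx =>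
    (L.smul_mem_iff hc).1 hx
  have hM := ad_identity (RM η i j) A _ (RM_cube η hη i j hij) L (fun A hA => hL A hA _ (hR i j)) hA
  rw [RM_proj η hη i j hij] at hM
  have hex : ∃ α β : ℝ, β ≠ 0 ∧ α • (single i i 1 - single j j 1) + β • SM η i j ∈ L := by
    by_cases hb : A i j + η i * η j * A j i = 0
    · have ha : A i i - A j j ≠ 0 := by
        intro ha
        apply hA'
        refine ⟨sub_eq_zero.1 ha, ?_⟩
        have := hη i
        linear_combination η i * hb - (η j * A j i) * this
      rw [hb, zero_smul, add_zero] at hM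
      have := hL _ (hsm _ _ ha hM) _ (hR i j)
      rw [br_D_R η hη i j hij] at this
      exact ⟨0, -2 * η j, mul_ne_zero (by norm_num) (hη0 j), by simpa using this⟩
    · exact ⟨_, _, hb, hM⟩
  obtain ⟨α, β, hβ, hM⟩ := hex
  obtain ⟨k, hki, hkj⟩ := third i j
  have hb1 := br_D_R η hη i k hki.symm
  have hb2 := br_S_R' η hη i j k hki.symm hij hkj.symm
  have hb3 := br_S_R'' η hη i j k hki.symm hij hkj.symm
  have hb4 := br_S_R η hη i k hki.symm
  have hb5 := br_E_R η hη i k hki.symm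
  have hb6 : single j j 1 * RM η i k - RM η i k * single j j 1 = 0 := by
    simp only [RM, mul_sub, sub_mul, smul_mul_assoc, mul_smul_comm, sm, hij.symm, hij, hkj, hkj.symm, if_false]
    simp
  have m1 : (-α * η k) • SM η i k + (- β * η i) • SM η k j ∈ L := by
    have := hL _ hM _ (hR i k)
    convert this using 1
    calc _ = α • (- η k • SM η i k - 0) + β • ((- η i) • SM η k j) := by module
      _ = _ := by
        rw [← hb5, ← hb2, ← hb6]
        simp only [mul_add, mul_sub, sub_mul, add_mul, smul_mul_assoc, mul_smul_comm]
        module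
  have m2 : (-2 * α * η k * η i) • (single i i 1 - single k k 1) + (- β * η i * η k) • SM η i j ∈ L := by
    have := hL _ m1 _ (hR i k)
    convert this using 1
    calc _ = (-α * η k) • ((2 * η i) • (single i i 1 - single k k 1)) + (- β * η i) • ((η k) • SM η i j) := by module
      _ = _ := by
        rw [← hb4, ← hb3]
        simp only [mul_add, mul_sub, sub_mul, add_mul, smul_mul_assoc, mul_smul_comm]
        module
  have m3 : (4 * α * η i) • SM η i k + (β * η k) • SM η k j ∈ L := by
    have := hL _ m2 _ (hR i k)
    convert this using 1
    calc _ = (-2 * α * η k * η i) • ((-2 * η k) • SM η i k) + (- β * η i * η k) • ((- η i) • SM η k j) := by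
          have := hη i
          have := hη k
          match_scalars <;> grind
      _ = _ := by
        rw [← hb1, ← hb2]
        simp only [mul_add, mul_sub, sub_mul, add_mul, smul_mul_assoc, mul_smul_comm]
        module
  have m4 : SM η k j ∈ L := by
    apply hsm (-3 * η k * β) _ (mul_ne_zero (mul_ne_zero (by norm_num) (hη0 k)) hβ)
    convert L.add_mem m3 (L.smul_mem (4 * η i * η k) m1) using 1
    have := hη i
    have := hη k
    match_scalars <;> grind
  have hS1 : ∀ a b c, a ≠ b → c ≠ b → SM η a b ∈ L → SM η c b ∈ L := by
    intro a b c hab hcb hS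
    by_cases hac : a = c
    · subst hac; exact hS
    have := hL _ hS _ (hR a c)
    rw [br_S_R' η hη a b c hac hab hcb.symm] at this
    exact hsm _ _ (neg_ne_zero.2 (hη0 a)) this
  have hS2 : ∀ a b, SM η a b ∈ L → SM η b a ∈ L := by
    intro a b hS
    convert L.smul_mem (η a * η b) hS using 1
    have := hη a
    have := hη b
    simp only [SM]
    match_scalars <;> grind
  have hS : ∀ a b, a ≠ b → SM η a b ∈ L := by
    intro a b hab
    by_cases hb : b = j
    · subst hb; exact hS1 k _ a hkj hab m4
    · have : SM η b j ∈ L := hS1 k _ b hkj hb m4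
      exact hS1 j b a (Ne.symm hb) hab (hS2 _ _ this)
  have hE : ∀ a b, a ≠ b → single a b (1:ℝ) ∈ L := by
    intro a b hab
    apply hsm (2 * η b) _ (mul_ne_zero (by norm_num) (hη0 b))
    convert L.sub_mem (L.smul_mem (η b) (hS a b hab)) (hR a b) using 1
    have := hη b
    simp only [SM, RM]
    match_scalars <;> grind
  have hD : ∀ a b, single a a (1:ℝ) - single b b 1 ∈ L := by
    intro a b
    by_cases hab : a = b
    · subst hab; simp
    · have := hL _ (hE a b hab) _ (hE b a (Ne.symm hab))
      simpa [sm] using this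
  have hE' : ∀ a b, single a b (1:ℝ) ∈ L := by
    intro a b
    by_cases hab : a = b
    · subst hab
      have h2 := L.add_mem h1 (L.sum_mem (t := Finset.univ) (fun b _ => hD a b))
      apply hsm (n : ℝ) _ (by norm_cast; omega)
      convert h2 using 1
      rw [Finset.sum_sub_distrib, ← Matrix.sum_single_one]
      simp
    · exact hE a b hab
  rw [eq_top_iff]
  intro B _
  rw [matrix_eq_sum_single B]
  refine L.sum_mem fun a _ => L.sum_mem fun b _ => ?_
  have := L.smul_mem (B a b) (hE' a b)
  rwa [Matrix.smul_single, smul_eq_mul, mul_one] at this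
end

section
variable {n : ℕ}

lemma vb_single_left (i : Fin n) (f : MvPolynomial (Fin n) ℝ) (Y : VectPol n) (k : Fin n) :
    vbracket (Pi.single i f) Y k
      = f * pderiv i (Y k) - (if k = i then ∑ l, Y l * pderiv l f else 0) := by
  unfold vbracket
  rw [Finset.sum_sub_distrib]
  congr 1
  · rw [Finset.sum_eq_single i]
    · simp
    · intro b _ hb; simp [hb]
    · simp
  · by_cases h : k = i
    · subst h; simp
    · simp [h]

lemma vb_single_single (i j : Fin n) (f g : MvPolynomial (Fin n) ℝ) :
    vbracket (Pi.single i f) (Pi.single j g)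
      = Pi.single j (f * pderiv i g) - Pi.single i (g * pderiv j f) := by
  funext k
  rw [vb_single_left]
  have : ∑ l, (Pi.single j g : VectPol n) l * pderiv l f = g * pderiv j f := by
    rw [Finset.sum_eq_single j]
    · simp
    · intro b _ hb; simp [hb]
    · simp
  rw [this]
  simp only [Pi.sub_apply, Pi.single_apply]
  split_ifs <;> simp

/-- linear vector fields -/
noncomputable def VL : Matrix (Fin n) (Fin n) ℝ →ₗ[ℝ] VectPol n where
  toFun A := fun k => ∑ j, C (A k j) * X j
  map_add' A B := by
    funext k
    simp [add_mul, Finset.sum_add_distrib]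
  map_smul' c A := by
    funext k
    simp [Finset.smul_sum, smul_eq_C_mul, mul_assoc]

lemma VL_apply (A : Matrix (Fin n) (Fin n) ℝ) (k : Fin n) : VL A k = ∑ j, C (A k j) * X j := rfl

lemma pderiv_VL (A : Matrix (Fin n) (Fin n) ℝ) (i k : Fin n) : pderiv i (VL A k) = C (A k i) := by
  rw [VL_apply, map_sum, Finset.sum_eq_single i]
  · simp
  · intro b _ hb; simp [pderiv_X_of_ne hb]
  · simp

lemma vb_VL (A B : Matrix (Fin n) (Fin n) ℝ) : vbracket (VL A) (VL B) = VL (B * A - A * B) := by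
  have key : ∀ (A B : Matrix (Fin n) (Fin n) ℝ) (k : Fin n), ∑ i, VL A i * C (B k i) = VL (B * A) k := by
    intro A B k
    simp only [VL_apply, Matrix.mul_apply, map_sum, Finset.sum_mul, map_mul]
    rw [Finset.sum_comm]
    refine Finset.sum_congr rfl fun i _ => Finset.sum_congr rfl fun j _ => ?_
    ring
  funext k
  unfold vbracket
  simp only [pderiv_VL, Finset.sum_sub_distrib, key, map_sub, Pi.sub_apply]

lemma VL_single (i j : Fin n) : VL (Matrix.single i j (1:ℝ)) = Pi.single i (X j) := by
  funext k
  rw [VL_apply]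
  by_cases h : k = i
  · subst h
    rw [Finset.sum_eq_single j]
    · simp
    · intro b _ hb; simp [Matrix.single_apply, hb.symm]
    · simp
  · simp [Matrix.single_apply, h, Ne.symm h]

lemma pderiv_pd_comm (i j : Fin n) (f : MvPolynomial (Fin n) ℝ) :
    pderiv i (pderiv j f) = pderiv j (pderiv i f) := by
  ext m
  simp only [coeff_pderiv]
  by_cases h : i = j
  · subst h; rfl
  · rw [add_right_comm]
    simp [h, Ne.symm h]
    ring

lemma const_of_pderiv (f : MvPolynomial (Fin n) ℝ) (hf : ∀ i, pderiv i f = 0) : f = C (coeff 0 f) := by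
  ext m
  rw [coeff_C]
  split_ifs with h
  · rw [h]
  · obtain ⟨i, hi⟩ : ∃ i, m i ≠ 0 := by
      by_contra hc
      push Not at hc
      exact h (by ext i; simp [hc i])
    have := congrArg (coeff (m - Finsupp.single i 1)) (hf i)
    rw [coeff_pderiv, Finsupp.sub_add_single_one_cancel hi] at this
    simp only [coeff_zero, mul_eq_zero] at this
    rcases this with h1 | h1
    · exact h1
    · exfalso
      exact absurd h1 (Nat.cast_add_one_ne_zero _)

lemma affine_of_pderiv (f : MvPolynomial (Fin n) ℝ) (hf : ∀ i j, pderiv i (pderiv j f) = 0) :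
    ∃ (a : ℝ) (b : Fin n → ℝ), f = C a + ∑ j, C (b j) * X j := by
  let b : Fin n → ℝ := fun j => coeff 0 (pderiv j f)
  have hb : ∀ j, pderiv j f = C (b j) := fun j => const_of_pderiv _ (fun i => hf i j)
  refine ⟨coeff 0 (f - ∑ j, C (b j) * X j), b, ?_⟩
  rw [← const_of_pderiv (f - ∑ j, C (b j) * X j)]
  · ring
  · intro i
    rw [map_sub, hb, map_sum, Finset.sum_eq_single i]
    · simp
    · intro b _ hb; simp [pderiv_X_of_ne hb]
    · simp

lemma pderiv_affine (a : ℝ) (b : Fin n → ℝ) (i : Fin n) :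
    pderiv i (C a + ∑ j, C (b j) * X j : MvPolynomial (Fin n) ℝ) = C (b i) := by
  rw [map_add, map_sum, Finset.sum_eq_single i]
  · simp
  · intro b _ hb; simp [pderiv_X_of_ne hb]
  · simp

/-- conformal Killing equation -/
def KE (η : Fin n → ℝ) (Y : VectPol n) (lam : MvPolynomial (Fin n) ℝ) : Prop :=
  ∀ i j, C (η j) * pderiv i (Y j) + C (η i) * pderiv j (Y i) = if i = j then C 2 * C (η i) * lam else 0

lemma KE.add {η : Fin n → ℝ} {Y Z : VectPol n} {l m : MvPolynomial (Fin n) ℝ} (hY : KE η Y l) (hZ : KE η Z m) :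
    KE η (Y + Z) (l + m) := by
  intro i j
  have h1 := hY i j
  have h2 := hZ i j
  simp only [Pi.add_apply, map_add]
  split_ifs at * <;> linear_combination h1 + h2

lemma KE.smul {η : Fin n → ℝ} {Y : VectPol n} {l : MvPolynomial (Fin n) ℝ} (c : ℝ) (hY : KE η Y l) :
    KE η (c • Y) (c • l) := by
  intro i j
  have h1 := hY i j
  simp only [Pi.smul_apply, smul_eq_C_mul, pderiv_C_mul]
  split_ifs at * <;> linear_combination C c * h1

lemma KE.sum {η : Fin n → ℝ} {Y : Fin n → VectPol n} {l : Fin n → MvPolynomial (Fin n) ℝ}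
    (hY : ∀ a, KE η (Y a) (l a)) (s : Finset (Fin n)) :
    KE η (∑ a ∈ s, Y a) (∑ a ∈ s, l a) := by
  induction s using Finset.induction_on with
  | empty => intro i j; simp
  | insert a s ha ih => rw [Finset.sum_insert ha, Finset.sum_insert ha]; exact (hY a).add ih

lemma KE_euler (η : Fin n → ℝ) : KE η (fun k => X k) 1 := by
  intro i j
  by_cases h : i = j
  · subst h
    simp only [pderiv_X_self, if_true]
    rw [show (C 2 : MvPolynomial (Fin n) ℝ) = 2 from rfl]; ring
  · simp [h, pderiv_X_of_ne h, pderiv_X_of_ne (Ne.symm h)]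

/-- special conformal fields -/
noncomputable def KF (η : Fin n → ℝ) (i : Fin n) : VectPol n :=
  fun k => (if k = i then ∑ j, C (η j) * X j * X j else 0) - C 2 * C (η i) * X i * X k

lemma pderiv_KF (η : Fin n → ℝ) (i a k : Fin n) :
    pderiv a (KF η i k) = (if k = i then C 2 * C (η a) * X a else 0)
      - C 2 * C (η i) * ((if a = i then X k else 0) + (if a = k then X i else 0)) := by
  have hQ : pderiv a (∑ j, C (η j) * X j * X j : MvPolynomial (Fin n) ℝ) = C 2 * C (η a) * X a := by
    rw [map_sum, Finset.sum_eq_single a]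
    · rw [mul_assoc, pderiv_C_mul, pderiv_mul, pderiv_X_self]
      rw [show (C 2 : MvPolynomial (Fin n) ℝ) = 2 from rfl]; ring
    · intro b _ hb; simp [pderiv_X_of_ne hb, pderiv_mul]
    · simp
  unfold KF
  rw [map_sub, apply_ite (pderiv a), hQ, map_zero, mul_assoc (C 2 * C (η i)), ← map_mul (C : ℝ →+* MvPolynomial (Fin n) ℝ) 2 (η i), pderiv_C_mul, pderiv_mul]
  congr 2
  by_cases h1 : a = i
  · subst h1
    by_cases h2 : a = k
    · subst h2; simp
    · simp [h2, pderiv_X_of_ne (Ne.symm h2)]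
  · by_cases h2 : a = k
    · subst h2; simp [h1, pderiv_X_of_ne (Ne.symm h1)]
    · simp [h1, h2, pderiv_X_of_ne (Ne.symm h2), pderiv_X_of_ne (Ne.symm h1)]

lemma KE_KF (η : Fin n → ℝ) (i : Fin n) : KE η (KF η i) ((-2 * η i) • X i) := by
  intro a b
  rw [pderiv_KF, pderiv_KF, smul_eq_C_mul, map_mul, map_neg]
  rw [show (C 2 : MvPolynomial (Fin n) ℝ) = 2 from rfl]
  split_ifs <;> (try subst_vars) <;> first | ring1 | grind

lemma killing_aux (hn : 3 ≤ n) (η : Fin n → ℝ) (hη : ∀ i, η i * η i = 1) (Y : VectPol n)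
    (lam : MvPolynomial (Fin n) ℝ) (hY : KE η Y lam) :
    (∀ i j, pderiv i (pderiv j lam) = 0) ∧
    ((∀ i, pderiv i lam = 0) → ∀ i j k, pderiv i (pderiv j (Y k)) = 0) := by
  have third : ∀ a b : Fin n, ∃ c, c ≠ a ∧ c ≠ b := by
    intro a b
    have : ({a, b} : Finset (Fin n)).card < (Finset.univ : Finset (Fin n)).card := by
      have := Finset.card_le_two (a := a) (b := b)
      simp; omega
    obtain ⟨c, -, hc⟩ := Finset.exists_mem_notMem_of_card_lt_card this
    simp at hc
    exact ⟨c, hc.1, hc.2⟩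
  have hC : ∀ i, (C (η i) : MvPolynomial (Fin n) ℝ) * C (η i) = 1 := by
    intro i; rw [← map_mul, hη, map_one]
  have h2C : ∀ f : MvPolynomial (Fin n) ℝ, C 2 * f = 0 → f = 0 := by
    intro f hf
    rcases mul_eq_zero.1 hf with h | h
    · simp at h
    · exact h
  have hC0 : ∀ i (f : MvPolynomial (Fin n) ℝ), C (η i) * f = 0 → f = 0 := by
    intro i f hf
    linear_combination C (η i) * hf - f * hC i
  have e2 : (C 2 : MvPolynomial (Fin n) ℝ) = 2 := rfl
  obtain ⟨ξ, hξ⟩ : ∃ ξ : VectPol n, ∀ i, ξ i = C (η i) * Y i := ⟨fun i => C (η i) * Y i, fun _ => rfl⟩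
  have k1 : ∀ i j, i ≠ j → pderiv i (ξ j) = - pderiv j (ξ i) := by
    intro i j hij
    have := hY i j
    rw [if_neg hij] at this
    rw [hξ, hξ, pderiv_C_mul, pderiv_C_mul]
    linear_combination this
  have k2 : ∀ i, pderiv i (ξ i) = C (η i) * lam := by
    intro i
    have := hY i i
    rw [if_pos rfl] at this
    rw [hξ, pderiv_C_mul]
    have := h2C (C (η i) * pderiv i (Y i) - C (η i) * lam) (by rw [e2] at *; linear_combination this)
    linear_combination this
  have sy := fun i j k => pderiv_pd_comm i j (ξ k)
  have d1 : ∀ k i j, i ≠ j → pderiv k (pderiv i (ξ j)) = - pderiv k (pderiv j (ξ i)) := by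
    intro k i j hij
    rw [k1 i j hij, map_neg]
  have d2 : ∀ k i, pderiv k (pderiv i (ξ i)) = C (η i) * pderiv k lam := by
    intro k i
    rw [k2, pderiv_C_mul]
  have d3 : ∀ i j k, i ≠ j → j ≠ k → i ≠ k → pderiv i (pderiv j (ξ k)) = 0 := by
    intro i j k hij hjk hik
    have a1 := d1 i j k hjk
    have a2 := sy i k j
    have a3 := d1 k i j hij
    have a4 := sy k j i
    have a5 := d1 j k i hik.symm
    have a6 := sy j i k
    apply h2C
    rw [e2]
    linear_combination a1 - a2 - a3 + a4 + a5 - a6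
  have d4 : ∀ i j, i ≠ j → pderiv i (pderiv i (ξ j)) = - (C (η i) * pderiv j lam) := by
    intro i j hij
    rw [d1 i i j hij, sy, d2]
  refine ⟨?_, ?_⟩
  · have l1 : ∀ i j, i ≠ j → C (η i) * pderiv j (pderiv j lam) = - (C (η j) * pderiv i (pderiv i lam)) := by
      intro i j hij
      rw [← pderiv_C_mul, ← d2, sy, pderiv_pd_comm, d4 j i hij.symm, map_neg, pderiv_C_mul]
    have l2 : ∀ i j, i ≠ j → C (η j) * pderiv j (pderiv j lam) = - (C (η i) * pderiv i (pderiv i lam)) := by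
      intro i j hij
      have := l1 i j hij
      linear_combination C (η i) * C (η j) * this - C (η j) * pderiv j (pderiv j lam) * hC i - C (η i) * pderiv i (pderiv i lam) * hC j
    intro i j
    by_cases hij : i = j
    · subst hij
      obtain ⟨j, hj, -⟩ := third i i
      obtain ⟨k, hki, hkj⟩ := third i j
      have a1 := l2 i j hj.symm
      have a2 := l2 j k hkj.symm
      have a3 := l2 k i hki
      apply hC0 i
      apply h2C
      rw [e2]
      linear_combination a3 - a2 + a1
    · obtain ⟨k, hki, hkj⟩ := third i j
      apply hC0 k
      rw [← pderiv_C_mul, ← d2, sy, pderiv_pd_comm, d3 i j k hij hkj.symm hki.symm, map_zero]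
  · intro hl i j k
    apply hC0 k
    rw [← pderiv_C_mul, ← pderiv_C_mul, ← hξ]
    by_cases hjk : j = k
    · subst hjk; rw [d2, hl, mul_zero]
    by_cases hik : i = k
    · subst hik; rw [sy, d2, hl, mul_zero]
    by_cases hij : i = j
    · subst hij; rw [d4 _ _ hik, hl, mul_zero, neg_zero]
    exact d3 i j k hij hjk hik

lemma killing_mem (hn : 3 ≤ n) (η : Fin n → ℝ) (hη : ∀ i, η i * η i = 1) (Y : VectPol n)
    (lam : MvPolynomial (Fin n) ℝ) (hY : KE η Y lam) (g : Submodule ℝ (VectPol n))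
    (hT : ∀ i, Pi.single i 1 ∈ g) (hR : ∀ i j, VL (RM η i j) ∈ g) (hE : (fun k => X k) ∈ g)
    (hK : ∀ i, KF η i ∈ g) : Y ∈ g := by
  obtain ⟨c, b, hlam⟩ := affine_of_pderiv lam (killing_aux hn η hη Y lam hY).1
  let W : VectPol n := (-c) • (fun k => X k) + ∑ i, (η i * b i / 2) • KF η i
  have hW : W ∈ g := g.add_mem (g.smul_mem _ hE) (g.sum_mem fun i _ => g.smul_mem _ (hK i))
  suffices h : Y + W ∈ g by
    have := g.sub_mem h hW
    simpa using this
  have hZ : KE η (Y + W) 0 := by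
    have := hY.add (((KE_euler η).smul (-c)).add (KE.sum (fun i => (KE_KF η i).smul (η i * b i / 2)) Finset.univ))
    convert this using 1
    have : ∀ i, (η i * b i / 2) • (-2 * η i) • (X i : MvPolynomial (Fin n) ℝ) = - (C (b i) * X i) := by
      intro i
      rw [smul_smul, smul_eq_C_mul, show η i * b i / 2 * (-2 * η i) = - b i by linear_combination (- b i) * hη i]
      simp
    simp only [this]
    simp only [hlam, smul_eq_C_mul, Finset.sum_neg_distrib]
    simp only [map_neg]
    ring
  generalize Y + W = Z at hZ
  have h2 := (killing_aux hn η hη Z 0 hZ).2 (fun i => map_zero _)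
  choose a B hB using fun k => affine_of_pderiv (Z k) (fun i j => h2 i j k)
  have hanti : ∀ i j, η j * B j i + η i * B i j = 0 := by
    intro i j
    have := hZ i j
    rw [hB, hB, pderiv_affine, pderiv_affine, mul_zero, ite_self, ← map_mul, ← map_mul, ← map_add] at this
    exact (C_eq_zero).1 this
  have hBm : (Matrix.of B) = ∑ k, ∑ j, (1/2 * B k j * η j) • RM η j k := by
    ext x y
    simp only [RM, Matrix.sum_apply, Matrix.smul_apply, Matrix.sub_apply, Matrix.single_apply, Matrix.of_apply, smul_eq_mul, mul_ite, mul_one, mul_zero, mul_sub, Finset.sum_sub_distrib, ite_and]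
    simp
    have e1 := hanti x y
    have e2 := hη x
    have e3 := hη y
    linear_combination (-1/2) * B x y * e3 + (1/2) * η x * e1 - (1/2) * B x y * e2
  have hZ' : Z = ∑ k, (a k) • (Pi.single k 1 : VectPol n) + VL (Matrix.of B) := by
    funext k
    rw [Pi.add_apply, Finset.sum_apply, VL_apply, Finset.sum_eq_single k, hB k]
    · simp [smul_eq_C_mul]
    · intro b _ hb; simp [hb.symm]
    · simp
  rw [hZ', hBm]
  simp only [map_sum, map_smul]
  exact g.add_mem (g.sum_mem fun i _ => g.smul_mem _ (hT i))
    (g.sum_mem fun i _ => g.sum_mem fun j _ => g.smul_mem _ (hR _ _))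

end

section
variable {n : ℕ}

lemma eig_mem (h : Submodule ℝ (VectPol n)) (T : VectPol n →ₗ[ℝ] VectPol n) (hT : ∀ Y ∈ h, T Y ∈ h)
    (μ : ℕ → ℝ) (hμ : Function.Injective μ) (s : Finset ℕ) :
    ∀ v : ℕ → VectPol n, (∀ d, T (v d) = μ d • v d) → ∑ d ∈ s, v d ∈ h → ∀ d ∈ s, v d ∈ h := by
  induction s using Finset.induction_on with
  | empty => simp
  | insert a s ha ih =>
    intro v hv hs
    have h1 := h.sub_mem (hT _ hs) (h.smul_mem (μ a) hs)
    have h2 : ∑ d ∈ s, (μ d - μ a) • v d ∈ h := by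
      convert h1 using 1
      rw [map_sum, Finset.smul_sum, ← Finset.sum_sub_distrib, Finset.sum_insert ha, hv]
      simp [hv, sub_smul]
    have h3 := ih (fun d => (μ d - μ a) • v d) (fun d => by rw [map_smul, hv, smul_comm]) h2
    have h4 : ∀ d ∈ s, v d ∈ h := by
      intro d hd
      refine (h.smul_mem_iff (sub_ne_zero.2 fun e => ?_)).1 (h3 d hd)
      rw [hμ e] at hd
      exact ha hd
    intro d hd
    rcases Finset.mem_insert.1 hd with rfl | hd
    · rw [Finset.sum_insert ha] at hs
      have := h.sub_mem hs (h.sum_mem h4)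
      simpa using this
    · exact h4 d hd

/-- bracket with the Euler field -/
noncomputable def adE : VectPol n →ₗ[ℝ] VectPol n where
  toFun Y := vbracket (fun k => X k) Y
  map_add' Y Z := by
    funext k
    simp only [vbracket, Pi.add_apply, map_add, ← Finset.sum_add_distrib]
    exact Finset.sum_congr rfl fun i _ => by ring
  map_smul' c Y := by
    funext k
    simp only [vbracket, Pi.smul_apply, smul_eq_C_mul, pderiv_C_mul, RingHom.id_apply, Finset.mul_sum]
    exact Finset.sum_congr rfl fun i _ => by ring

lemma adE_hom (Y : VectPol n) (d : ℕ) (hY : ∀ k, (Y k).IsHomogeneous d) :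
    adE Y = ((d : ℝ) - 1) • Y := by
  funext k
  change ∑ i, (X i * pderiv i (Y k) - Y i * pderiv i (X k)) = _
  rw [Finset.sum_sub_distrib, (hY k).sum_X_mul_pderiv, Finset.sum_eq_single k]
  · simp only [pderiv_X_self, Pi.smul_apply, sub_smul, one_smul, mul_one, Nat.cast_smul_eq_nsmul]
  · intro b _ hb; simp [pderiv_X_of_ne hb.symm]
  · simp

lemma vb_trans (i : Fin n) (Y : VectPol n) : vbracket (Pi.single i 1) Y = fun k => pderiv i (Y k) := by
  funext k
  rw [vb_single_left]
  simp

lemma hom_zero {f : MvPolynomial (Fin n) ℝ} {d : ℕ} (hd : d ≠ 0) (hf : f.IsHomogeneous d)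
    (h : ∀ i, pderiv i f = 0) : f = 0 := by
  rw [const_of_pderiv f h, hf.coeff_eq_zero (by simpa using hd.symm), map_zero]

lemma hom_zero_deriv {f : MvPolynomial (Fin n) ℝ} (hf : f.IsHomogeneous 0) (i : Fin n) : pderiv i f = 0 := by
  have : f.totalDegree = 0 := (totalDegree_zero_iff_isHomogeneous _).2 hf
  rw [totalDegree_eq_zero_iff_eq_C.1 this, pderiv_C]

lemma hom_killing (η : Fin n → ℝ) (h : Submodule ℝ (VectPol n))
    (hbr : ∀ Y ∈ h, ∀ Z ∈ h, vbracket Y Z ∈ h) (hT : ∀ i, Pi.single i 1 ∈ h)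
    (hco : ∀ A, VL A ∈ h → ∀ i j, i ≠ j → (A i i = A j j ∧ η j * A j i + η i * A i j = 0)) (d : ℕ) :
    ∀ Y ∈ h, (∀ k, (Y k).IsHomogeneous d) → ∀ i j, i ≠ j →
      pderiv i (Y i) = pderiv j (Y j) ∧ C (η j) * pderiv i (Y j) + C (η i) * pderiv j (Y i) = 0 := by
  induction d with
  | zero =>
    intro Y _ hY i j _
    simp [hom_zero_deriv (hY _)]
  | succ d ih =>
    intro Y hYh hY i j hij
    by_cases hd : d = 0
    · subst hd
      have hY1 : ∀ i k, (pderiv i (Y k)).IsHomogeneous 0 := fun i k => (hY k).pderiv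
      choose a B hB using fun k => affine_of_pderiv (Y k) (fun i j => hom_zero_deriv (hY1 j k) i)
      have ha : ∀ k, a k = 0 := by
        intro k
        have h0 : coeff 0 (Y k) = 0 := (hY k).coeff_eq_zero (by simp)
        rw [hB k] at h0
        simpa [← constantCoeff_eq] using h0
      have hYA : Y = VL (Matrix.of B) := by
        funext k
        rw [hB k, ha k, VL_apply]
        simp
      rw [hYA] at hYh ⊢
      have := hco _ hYh i j hij
      simp only [pderiv_VL]
      rw [this.1, ← map_mul, ← map_mul, ← map_add, this.2]
      simp
    · have hder : ∀ k, pderiv i (pderiv k (Y i)) = pderiv j (pderiv k (Y j)) ∧ C (η j) * pderiv i (pderiv k (Y j)) + C (η i) * pderiv j (pderiv k (Y i)) = 0 := by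
        intro k
        have h1 := hbr _ (hT k) _ hYh
        rw [vb_trans] at h1
        exact ih _ h1 (fun l => (hY l).pderiv) i j hij
      have hh : ∀ i k, (pderiv i (Y k)).IsHomogeneous d := fun i k => (hY k).pderiv
      constructor
      · rw [← sub_eq_zero]
        apply hom_zero hd ((hh i i).sub (hh j j))
        intro k
        rw [map_sub, pderiv_pd_comm k i, pderiv_pd_comm k j, (hder k).1, sub_self]
      · apply hom_zero hd
        · apply IsHomogeneous.add
          · simpa using (isHomogeneous_C _ (η j)).mul (hh i j)
          · simpa using (isHomogeneous_C _ (η i)).mul (hh j i)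
        intro k
        rw [map_add, pderiv_C_mul, pderiv_C_mul, pderiv_pd_comm k i, pderiv_pd_comm k j, (hder k).2]

lemma case_conf (hn : 3 ≤ n) (η : Fin n → ℝ) (hη : ∀ i, η i * η i = 1) (h g : Submodule ℝ (VectPol n))
    (hbr : ∀ Y ∈ h, ∀ Z ∈ h, vbracket Y Z ∈ h) (hgh : g ≤ h)
    (hT : ∀ i, Pi.single i 1 ∈ g) (hR : ∀ i j, VL (RM η i j) ∈ g) (hE : (fun k => X k) ∈ g)
    (hK : ∀ i, KF η i ∈ g)
    (hco : ∀ A, VL A ∈ h → ∀ i j, i ≠ j → (A i i = A j j ∧ η j * A j i + η i * A i j = 0)) : h ≤ g := by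
  have hhom : ∀ d, ∀ Y ∈ h, (∀ k, (Y k).IsHomogeneous d) → Y ∈ g := by
    intro d Y hY hYd
    have hk := hom_killing η h hbr (fun i => hgh (hT i)) hco d Y hY hYd
    refine killing_mem hn η hη Y (pderiv (⟨0, by omega⟩ : Fin n) (Y ⟨0, by omega⟩)) ?_ g hT hR hE hK
    intro i j
    have e2 : (C 2 : MvPolynomial (Fin n) ℝ) = 2 := rfl
    split_ifs with hij
    · subst hij
      have : pderiv i (Y i) = pderiv (⟨0, by omega⟩ : Fin n) (Y ⟨0, by omega⟩) := by
        by_cases h0 : i = ⟨0, by omega⟩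
        · rw [← h0]
        · exact (hk _ _ h0).1
      rw [← this, e2]; ring
    · exact (hk i j hij).2
  intro Y hY
  let N := (Finset.univ.sup fun k => (Y k).totalDegree) + 1
  have hsum : Y = ∑ d ∈ Finset.range N, (fun k => homogeneousComponent d (Y k) : VectPol n) := by
    funext k
    rw [Finset.sum_apply]
    conv_lhs => rw [← sum_homogeneousComponent (Y k)]
    apply Finset.sum_subset
    · apply Finset.range_mono
      have := Finset.le_sup (f := fun k => (Y k).totalDegree) (Finset.mem_univ k)
      simp only [N]
      simpa using this
    · intro d _ hd
      apply homogeneousComponent_eq_zero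
      simp at hd
      omega
  have hcomp : ∀ d ∈ Finset.range N, (fun k => homogeneousComponent d (Y k) : VectPol n) ∈ h := by
    apply eig_mem h adE (fun Y hY => hbr _ (hgh hE) _ hY) (fun d => (d : ℝ) - 1) (by intro a b; simp)
      (Finset.range N) (fun d k => homogeneousComponent d (Y k))
    · intro d
      exact adE_hom _ d (fun k => homogeneousComponent_isHomogeneous d (Y k))
    · rw [← hsum]; exact hY
  rw [hsum]
  exact g.sum_mem fun d hd => hhom d _ (hcomp d hd) (fun k => homogeneousComponent_isHomogeneous d (Y k))

end

section
variable {n : ℕ}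

lemma quad_all_s3 (hn : 3 ≤ n) (η : Fin n → ℝ) (hη : ∀ i, η i * η i = 1) (h : Submodule ℝ (VectPol n))
    (hbr : ∀ Y ∈ h, ∀ Z ∈ h, vbracket Y Z ∈ h)
    (hK : ∀ i, KF η i ∈ h) (hlin : ∀ i j, (Pi.single i (X j) : VectPol n) ∈ h) (i j k : Fin n) :
    (Pi.single i (X j * X k) : VectPol n) ∈ h := by
  have hη0 : ∀ i, η i ≠ 0 := fun i h => by have := hη i; simp [h] at this
  have e2 : (C 2 : MvPolynomial (Fin n) ℝ) = 2 := rfl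
  have hsm : ∀ (c : ℝ) (x : VectPol n), c ≠ 0 → c • x ∈ h → x ∈ h := fun c x hc hx =>
    (h.smul_mem_iff hc).1 hx
  have q1 : ∀ i j, j ≠ i → (Pi.single i (X j * X j) : VectPol n) ∈ h := by
    intro i j hji
    apply hsm (2 * η j) _ (mul_ne_zero two_ne_zero (hη0 j))
    convert hbr _ (hlin j j) _ (hK i) using 1
    funext k
    rw [vb_single_left, pderiv_KF]
    have : ∑ l, KF η i l * pderiv l (X j) = KF η i j := by
      rw [Finset.sum_eq_single j]
      · simp
      · intro b _ hb; simp [pderiv_X_of_ne hb.symm]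
      · simp
    rw [this]
    simp only [KF, Pi.smul_apply, smul_eq_C_mul, Pi.single_apply, map_mul, hji, if_false]
    by_cases h1 : k = i
    · subst h1
      simp [hji, hji.symm]
      ring
    · by_cases h2 : k = j
      · subst h2; simp [h1]; ring
      · simp [h1, h2, Ne.symm h2]
  have q2 : ∀ i j k, j ≠ i → k ≠ i → (Pi.single i (X j * X k) : VectPol n) ∈ h := by
    intro i j k hji hki
    apply hsm 2 _ two_ne_zero
    convert hbr _ (hlin j k) _ (q1 i j hji) using 1
    rw [vb_single_single, pderiv_mul, pderiv_X_self, pderiv_X_of_ne hki, mul_zero, Pi.single_zero, sub_zero,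
      ← Pi.single_smul, smul_eq_C_mul, e2]
    congr 1; ring
  have q3 : ∀ i k, i ≠ k → (Pi.single i (X i * X i) : VectPol n) - (2 : ℝ) • (Pi.single k (X i * X k) : VectPol n) ∈ h := by
    intro i k hik
    convert hbr _ (q1 k i hik) _ (hlin i k) using 1
    rw [vb_single_single, pderiv_mul, pderiv_X_self, pderiv_X_self, ← Pi.single_smul, smul_eq_C_mul, e2]
    congr 2 <;> ring
  have q4 : ∀ i, (Pi.single i (X i * X i) : VectPol n) ∈ h := by
    intro i
    have hs1 := h.sum_mem (t := Finset.univ.erase i) (fun j hj => h.smul_mem (η j) (q1 i j (Finset.ne_of_mem_erase hj)))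
    have hs2 := h.sum_mem (t := Finset.univ.erase i) (fun k hk => q3 i k (Finset.ne_of_mem_erase hk).symm)
    have hs3 := h.sub_mem (h.add_mem hs1 (h.smul_mem (η i) hs2)) (hK i)
    apply hsm (n * η i) _ (mul_ne_zero (by norm_cast; omega) (hη0 i))
    convert hs3 using 1
    rw [Finset.sum_sub_distrib, Finset.sum_const, Finset.card_erase_of_mem (Finset.mem_univ i)]
    have hK' : KF η i = ∑ j ∈ Finset.univ.erase i, η j • (Pi.single i (X j * X j) : VectPol n)
        - η i • (Pi.single i (X i * X i) : VectPol n)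
        - η i • ∑ k ∈ Finset.univ.erase i, (2 : ℝ) • (Pi.single k (X i * X k) : VectPol n) := by
      rw [← sub_eq_zero]
      have t1 := Finset.add_sum_erase Finset.univ (fun j => η j • (Pi.single i (X j * X j) : VectPol n)) (Finset.mem_univ i)
      have t2 := Finset.add_sum_erase Finset.univ (fun k => (2 : ℝ) • (Pi.single k (X i * X k) : VectPol n)) (Finset.mem_univ i)
      have t3 : KF η i = ∑ j, η j • (Pi.single i (X j * X j) : VectPol n) - η i • ∑ k, (2 : ℝ) • (Pi.single k (X i * X k) : VectPol n) := by
        funext k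
        simp only [KF, Pi.sub_apply, Finset.sum_apply, Pi.smul_apply, smul_eq_C_mul]
        rw [Finset.sum_eq_single k (f := fun c => C 2 * (Pi.single c (X i * X c) : VectPol n) k)]
        · congr 1
          · by_cases hk : k = i
            · subst hk; simp [mul_assoc]
            · simp [hk]
          · simp; ring
        · intro b _ hb; simp [hb.symm]
        · simp
      rw [t3, ← t1, ← t2]
      module
    rw [hK']
    have hcard : (Finset.univ : Finset (Fin n)).card - 1 = n - 1 := by simp
    rw [hcard, ← Nat.cast_smul_eq_nsmul ℝ, Nat.cast_sub (by omega)]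
    push_cast
    module
  have q5 : ∀ i k, i ≠ k → (Pi.single k (X i * X k) : VectPol n) ∈ h := by
    intro i k hik
    have := h.sub_mem (q4 i) (q3 i k hik)
    apply hsm 2 _ two_ne_zero
    simpa using this
  by_cases hj : j = i
  · by_cases hk : k = i
    · subst hj; subst hk; exact q4 _
    · subst hj; rw [mul_comm]; exact q5 _ _ hk
  · by_cases hk : k = i
    · subst hk; exact q5 _ _ hj
    · exact q2 _ _ _ hj hk

lemma mono_all (hn : 3 ≤ n) (h : Submodule ℝ (VectPol n))
    (hbr : ∀ Y ∈ h, ∀ Z ∈ h, vbracket Y Z ∈ h)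
    (hT : ∀ i, (Pi.single i 1 : VectPol n) ∈ h)
    (hlin : ∀ i j, (Pi.single i (X j) : VectPol n) ∈ h)
    (hq : ∀ i j k, (Pi.single i (X j * X k) : VectPol n) ∈ h) (d : ℕ) :
    ∀ (b : Fin n →₀ ℕ), b.degree = d → ∀ i, (Pi.single i (monomial b 1) : VectPol n) ∈ h := by
  have hsm : ∀ (c : ℝ) (x : VectPol n), c ≠ 0 → c • x ∈ h → x ∈ h := fun c x hc hx =>
    (h.smul_mem_iff hc).1 hx
  have L1 : ∀ (a : Fin n →₀ ℕ) i j, j ≠ i → a i ≠ 1 → (Pi.single i (monomial a 1) : VectPol n) ∈ h →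
      (Pi.single i (monomial a 1 * X j) : VectPol n) ∈ h := by
    intro a i j hji ha hm
    apply hsm (1 - a i) _ (by rw [sub_ne_zero]; exact_mod_cast (Ne.symm ha))
    convert hbr _ hm _ (hq i i j) using 1
    rw [vb_single_single, ← Pi.single_sub, ← Pi.single_smul, pderiv_mul, pderiv_X_self, pderiv_X_of_ne hji]
    congr 1
    have := X_mul_pderiv_monomial (i := i) (m := a) (r := (1:ℝ))
    rw [← Nat.cast_smul_eq_nsmul ℝ, smul_eq_C_mul] at this
    rw [smul_eq_C_mul, map_sub, map_one]
    linear_combination (X j) * this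
  have L2 : ∀ (a : Fin n →₀ ℕ) i, a i ≠ 2 → (Pi.single i (monomial a 1) : VectPol n) ∈ h →
      (Pi.single i (monomial a 1 * X i) : VectPol n) ∈ h := by
    intro a i ha hm
    apply hsm (2 - a i) _ (by rw [sub_ne_zero]; exact_mod_cast (Ne.symm ha))
    convert hbr _ hm _ (hq i i i) using 1
    rw [vb_single_single, ← Pi.single_sub, ← Pi.single_smul, pderiv_mul, pderiv_X_self]
    congr 1
    have := X_mul_pderiv_monomial (i := i) (m := a) (r := (1:ℝ))
    rw [← Nat.cast_smul_eq_nsmul ℝ, smul_eq_C_mul] at this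
    rw [smul_eq_C_mul, map_sub, show (C 2 : MvPolynomial (Fin n) ℝ) = 2 from rfl]
    linear_combination (X i) * this
  have L3 : ∀ (a : Fin n →₀ ℕ) i j k, j ≠ i → k ≠ i → a k ≠ 0 → (Pi.single i (monomial a 1) : VectPol n) ∈ h →
      (Pi.single i (monomial a 1 * X j) : VectPol n) ∈ h := by
    intro a i j k hji hki ha hm
    apply hsm (a k) _ (by exact_mod_cast ha)
    convert hbr _ (hq k k j) _ hm using 1
    rw [vb_single_single, ← Pi.single_smul, pderiv_mul, pderiv_X_of_ne hji, pderiv_X_of_ne hki]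
    have := X_mul_pderiv_monomial (i := k) (m := a) (r := (1:ℝ))
    rw [← Nat.cast_smul_eq_nsmul ℝ, smul_eq_C_mul] at this
    simp only [zero_mul, mul_zero, add_zero, Pi.single_zero, sub_zero]
    congr 1
    rw [smul_eq_C_mul]
    linear_combination (- X j) * this
  have split : ∀ (b : Fin n →₀ ℕ) j, b j ≠ 0 → ∃ a : Fin n →₀ ℕ, b = a + Finsupp.single j 1 ∧
      b.degree = a.degree + 1 ∧ (monomial b (1:ℝ)) = monomial a 1 * X j := by
    intro b j hb
    have e := Finsupp.sub_add_single_one_cancel hb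
    refine ⟨b - Finsupp.single j 1, e.symm, ?_, ?_⟩
    · conv_lhs => rw [← e]
      rw [map_add, Finsupp.degree_single]
    · conv_lhs => rw [← e]
      rw [X, monomial_mul, one_mul]
  have pos : ∀ (b : Fin n →₀ ℕ), b.degree ≠ 0 → ∃ j, b j ≠ 0 := by
    intro b hb
    by_contra hc
    push Not at hc
    apply hb
    rw [show b = 0 by ext i; simp [hc i]]
    simp
  induction d with
  | zero =>
    intro b hb i
    rw [Finsupp.degree_eq_zero_iff] at hb
    subst hb
    exact hT i
  | succ d ih =>
    by_cases hd : d ≤ 1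
    · intro b hb i
      obtain ⟨j, hj⟩ := pos b (by omega)
      obtain ⟨a, -, had, ham⟩ := split b j hj
      rw [ham]
      by_cases h0 : a.degree = 0
      · rw [Finsupp.degree_eq_zero_iff] at h0
        subst h0
        simpa using hlin i j
      · obtain ⟨k, hk⟩ := pos a h0
        obtain ⟨c, -, hcd, hcm⟩ := split a k hk
        have : c.degree = 0 := by omega
        rw [Finsupp.degree_eq_zero_iff] at this
        subst this
        rw [hcm]
        simpa using hq i k j
    have c1 : ∀ (b : Fin n →₀ ℕ), b.degree = d + 1 → ∀ i j, j ≠ i → b j ≠ 0 →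
        (Pi.single i (monomial b 1) : VectPol n) ∈ h := by
      intro b hb i j hji hbj
      obtain ⟨a, hab, had, ham⟩ := split b j hbj
      rw [ham]
      have hm := ih a (by omega) i
      by_cases hai : a i = 1
      · obtain ⟨c, hac, hcd, -⟩ := split a i (by omega)
        obtain ⟨k, hk⟩ := pos c (by omega)
        have hci : c i = 0 := by
          rw [hac] at hai
          simpa using hai
        have hki : k ≠ i := by
          rintro rfl
          exact hk hci
        refine L3 a i j k hji hki ?_ hm
        rw [hac]
        simp; omega
      · exact L1 a i j hji hai hm
    intro b hb i
    by_cases hex : ∃ j, j ≠ i ∧ b j ≠ 0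
    · obtain ⟨j, h1, h2⟩ := hex
      exact c1 b hb i j h1 h2
    push Not at hex
    have hbi : b = Finsupp.single i (d + 1) := by
      have : b = Finsupp.single i (b i) := by
        ext j
        by_cases hj : j = i
        · subst hj; simp
        · rw [hex j hj, Finsupp.single_eq_of_ne hj]
      rw [this, Finsupp.degree_single] at hb
      rw [this, hb]
    by_cases hd2 : d = 2
    · subst hd2
      obtain ⟨k, hk⟩ : ∃ k : Fin n, k ≠ i := by
        have : Nontrivial (Fin n) := Fin.nontrivial_iff_two_le.2 (by omega)
        exact exists_ne i
      have hA := hbr _ (hq k i i) _ (hq i i k)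
      rw [vb_single_single, pderiv_mul, pderiv_mul, pderiv_X_self, pderiv_X_self, pderiv_X_of_ne hk.symm] at hA
      have hB := c1 (Finsupp.single i 2 + Finsupp.single k 1) (by simp) k i hk.symm (by simp)
      have hB' := h.add_mem hA (h.smul_mem 2 hB)
      convert hB' using 1
      have e : (monomial (Finsupp.single i 2 + Finsupp.single k 1) (1:ℝ)) = X i ^ 2 * X k := by
        rw [X_pow_eq_monomial, X, monomial_mul, one_mul]
      rw [hbi, ← X_pow_eq_monomial, e, ← Pi.single_smul, smul_eq_C_mul, show (C 2 : MvPolynomial (Fin n) ℝ) = 2 from rfl,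
        sub_add, ← Pi.single_sub]
      rw [show X i * X k * (1 * X i + X i * 1) - 2 * (X i ^ 2 * X k) = (0 : MvPolynomial (Fin n) ℝ) by ring,
        Pi.single_zero, sub_zero]
      congr 1
      ring
    · obtain ⟨a, hab, had, ham⟩ := split b i (by rw [hbi]; simp)
      rw [ham]
      refine L2 a i ?_ (ih a (by omega) i)
      have : b i = a i + 1 := by rw [hab]; simp
      rw [hbi, Finsupp.single_eq_same] at this
      omega

lemma top_of_mono (h : Submodule ℝ (VectPol n))
    (hm : ∀ (b : Fin n →₀ ℕ) i, (Pi.single i (monomial b 1) : VectPol n) ∈ h) : h = ⊤ := by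
  rw [eq_top_iff]
  intro Y _
  rw [← Finset.univ_sum_single Y]
  refine h.sum_mem fun i _ => ?_
  have : ∀ f : MvPolynomial (Fin n) ℝ, (Pi.single i f : VectPol n) ∈ h := by
    intro f
    induction f using MvPolynomial.induction_on' with
    | monomial u a =>
      have := h.smul_mem a (hm u i)
      rw [← Pi.single_smul, smul_monomial, smul_eq_mul, mul_one] at this
      exact this
    | add p q hp hq => rw [Pi.single_add]; exact h.add_mem hp hq
  exact this _

theorem main_aux (hn : 3 ≤ n) (η : Fin n → ℝ) (hη : ∀ i, η i * η i = 1) (h g : Submodule ℝ (VectPol n))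
    (hbr : ∀ Y ∈ h, ∀ Z ∈ h, vbracket Y Z ∈ h) (hgh : g < h)
    (hT : ∀ i, Pi.single i 1 ∈ g) (hR : ∀ i j, VL (RM η i j) ∈ g) (hE : (fun k => X k) ∈ g)
    (hK : ∀ i, KF η i ∈ g) : h = ⊤ := by
  by_cases hco : ∀ A, VL A ∈ h → ∀ i j, i ≠ j → (A i i = A j j ∧ η j * A j i + η i * A i j = 0)
  · exact absurd (case_conf hn η hη h g hbr hgh.le hT hR hE hK hco) (not_le_of_gt hgh)
  · push Not at hco
    obtain ⟨A, hA, i, j, hij, hne⟩ := hco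
    have hL : h.comap VL = ⊤ := by
      apply mat_top hn η hη (h.comap VL) ?_ ?_ (fun i j => hgh.le (hR i j)) A hA i j hij
        (fun hc => hne hc.1 hc.2)
      · intro A hA B hB
        rw [Submodule.mem_comap, ← vb_VL]
        exact hbr _ hB _ hA
      · rw [Submodule.mem_comap]
        convert hgh.le hE using 1
        funext k
        rw [VL_apply, Finset.sum_eq_single k]
        · simp
        · intro b _ hb; simp [Matrix.one_apply, hb.symm]
        · simp
    have hlin : ∀ i j, (Pi.single i (X j) : VectPol n) ∈ h := by
      intro i j
      have : Matrix.single i j (1:ℝ) ∈ h.comap VL := by rw [hL]; trivial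
      rwa [Submodule.mem_comap, VL_single] at this
    exact top_of_mono h fun b => mono_all hn h hbr (fun i => hgh.le (hT i)) hlin
      (quad_all_s3 hn η hη h hbr (fun i => hgh.le (hK i)) hlin) _ b rfl

end

/-- The subalgebra `g ≅ o(p+1, q+1)` spanned by the conformal generators is a maximal
Lie subalgebra of the Lie algebra of polynomial vector fields on ℝⁿ (`n = p + q ≥ 3`):
any Lie subalgebra `h` strictly containing it is the whole algebra. -/
theorem stmt3 (p q : ℕ) (hn : 3 ≤ p + q) (h : Submodule ℝ (VectPol (p + q)))
    (hbracket : ∀ Xv ∈ h, ∀ Yv ∈ h, vbracket Xv Yv ∈ h)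
    (hlt : Submodule.span ℝ (confGen p q) < h) :
    h = ⊤ := by
  refine main_aux hn (etaSgn p q) ?_ h (Submodule.span ℝ (confGen p q)) hbracket hlt ?_ ?_ ?_ ?_
  · intro i
    unfold etaSgn
    split_ifs <;> norm_num
  · intro i
    apply Submodule.subset_span
    refine Or.inl (Or.inl (Or.inl ⟨i, ?_⟩))
    funext k
    simp [Pi.single_apply]
  · intro i j
    apply Submodule.subset_span
    refine Or.inl (Or.inl (Or.inr ⟨(i, j), ?_⟩))
    funext k
    simp only [RM, map_sub, map_smul, VL_single, Pi.sub_apply, Pi.smul_apply, Pi.single_apply,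
      smul_eq_C_mul, mul_ite, mul_zero]
  · apply Submodule.subset_span
    exact Or.inl (Or.inr rfl)
  · intro i
    apply Submodule.subset_span
    exact Or.inr ⟨i, rfl⟩
end

section
/- Let n ≥ 1 and ℏ ∈ ℝ. For a smooth symmetric contravariant 2-tensor field g^{ij} on ℝ^n (g^{ij} = g^{ji}, smooth real-valued functions), define the differential operator Q(g) acting on smooth functions f : ℝ^n → ℝ by Q(g) f = −ℏ² ( g^{ij} ∂_i ∂_j f + (∂_j g^{ij}) ∂_i f + ((n+1)/(4(n+2))) (∂_i ∂_j g^{ij}) f ). For a polynomial vector field X = X^i ∂_i on ℝ^n, let (L_X g)^{ij} = X^k ∂_k g^{ij} − g^{kj} ∂_k X^i − g^{ik} ∂_k X^j (the Lie derivative of g), and let ℓ_X be the operator ℓ_X f = X^i ∂_i f + (1/2)(∂_i X^i) f (the action of X on half-densities in coordinates). Then for every X in the linear span of the projective generators ∂_i, x^i ∂_j, x^i E (where E = x^j ∂_j), one has Q(L_X g) = ℓ_X ∘ Q(g) − Q(g) ∘ ℓ_X as operators on smooth functions on ℝ^n. -/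
set_option maxHeartbeats 1000000

/-- The `i`-th partial derivative of a function on `ℝⁿ`. -/
noncomputable def pd {n : ℕ} (i : Fin n) (f : (Fin n → ℝ) → ℝ) : (Fin n → ℝ) → ℝ :=
  fun x => fderiv ℝ f x (Pi.single i 1)

/-- The projective generators on ℝⁿ, viewed as vector fields (families of component
functions): `∂ᵢ`, `xⁱ∂ⱼ`, and `xⁱE` where `E = xʲ∂ⱼ`. -/
def projGenSm (n : ℕ) : Set (Fin n → (Fin n → ℝ) → ℝ) :=
  (Set.range fun i : Fin n => fun m (_ : Fin n → ℝ) => if m = i then (1 : ℝ) else 0) ∪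
  (Set.range fun p : Fin n × Fin n => fun m (x : Fin n → ℝ) =>
    if m = p.2 then x p.1 else 0) ∪
  (Set.range fun i : Fin n => fun m (x : Fin n → ℝ) => x i * x m)

/-- The Lie derivative of a symmetric contravariant 2-tensor along a vector field:
`(L_X g)^{ij} = X^k ∂_k g^{ij} − g^{kj} ∂_k X^i − g^{ik} ∂_k X^j`. -/
noncomputable def lieDer {n : ℕ} (Xv : Fin n → (Fin n → ℝ) → ℝ)
    (g : Fin n → Fin n → (Fin n → ℝ) → ℝ) : Fin n → Fin n → (Fin n → ℝ) → ℝ :=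
  fun i j x => ∑ k, (Xv k x * pd k (g i j) x
    - g k j x * pd k (Xv i) x - g i k x * pd k (Xv j) x)

/-- The action of a vector field on half-densities, in coordinates:
`ℓ_X f = Xⁱ ∂ᵢ f + (1/2)(∂ᵢ Xⁱ) f`. -/
noncomputable def halfDensAct {n : ℕ} (Xv : Fin n → (Fin n → ℝ) → ℝ)
    (f : (Fin n → ℝ) → ℝ) : (Fin n → ℝ) → ℝ :=
  fun x => (∑ i, Xv i x * pd i f x) + (1 / 2) * (∑ i, pd i (Xv i) x) * f x

/-- The projectively equivariant quantization of the quadratic symbol `g^{ij} ξᵢ ξⱼ`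
at weights `λ = μ = 1/2`:
`Q(g) f = −ℏ²(g^{ij}∂ᵢ∂ⱼf + (∂ⱼg^{ij})∂ᵢf + ((n+1)/(4(n+2)))(∂ᵢ∂ⱼg^{ij})f)`. -/
noncomputable def Qproj {n : ℕ} (ℏ : ℝ) (g : Fin n → Fin n → (Fin n → ℝ) → ℝ)
    (f : (Fin n → ℝ) → ℝ) : (Fin n → ℝ) → ℝ :=
  fun x => -ℏ ^ 2 * ((∑ i, ∑ j, g i j x * pd i (pd j f) x)
    + (∑ i, ∑ j, pd j (g i j) x * pd i f x)
    + ((n + 1) / (4 * (n + 2))) * (∑ i, ∑ j, pd i (pd j (g i j)) x) * f x)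

def Sm {n : ℕ} (f : (Fin n → ℝ) → ℝ) : Prop := ContDiff ℝ (⊤ : ℕ∞) f

section
variable {n : ℕ}

lemma Sm.da {f : (Fin n → ℝ) → ℝ} (h : Sm f) (x) : DifferentiableAt ℝ f x :=
  (ContDiff.differentiable h (by simp)) x

lemma Sm.pd {f : (Fin n → ℝ) → ℝ} (h : Sm f) (i : Fin n) : Sm (pd i f) := by
  have h1 : ContDiff ℝ (⊤ : ℕ∞) (fderiv ℝ f) := ContDiff.fderiv_right h (by simp)
  exact h1.clm_apply contDiff_const

lemma Sm.add {f g : (Fin n → ℝ) → ℝ} (h : Sm f) (k : Sm g) : Sm (fun x => f x + g x) :=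
  ContDiff.add h k
lemma Sm.sub {f g : (Fin n → ℝ) → ℝ} (h : Sm f) (k : Sm g) : Sm (fun x => f x - g x) :=
  ContDiff.sub h k
lemma Sm.mul {f g : (Fin n → ℝ) → ℝ} (h : Sm f) (k : Sm g) : Sm (fun x => f x * g x) :=
  ContDiff.mul h k
lemma Sm.const (c : ℝ) : Sm (fun _ : Fin n → ℝ => c) := contDiff_const
lemma Sm.sum {f : Fin n → (Fin n → ℝ) → ℝ} (h : ∀ i, Sm (f i)) : Sm (fun x => ∑ i, f i x) :=
  ContDiff.sum fun i _ => h i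
lemma Sm.coord (i : Fin n) : Sm (fun x : Fin n → ℝ => x i) := contDiff_apply ℝ ℝ i

lemma pd_add {f g : (Fin n → ℝ) → ℝ} (h : Sm f) (k : Sm g) (i : Fin n) :
    pd i (fun x => f x + g x) = fun x => pd i f x + pd i g x := by
  funext x; unfold pd; rw [fderiv_fun_add (h.da x) (k.da x)]; rfl
lemma pd_sub {f g : (Fin n → ℝ) → ℝ} (h : Sm f) (k : Sm g) (i : Fin n) :
    pd i (fun x => f x - g x) = fun x => pd i f x - pd i g x := by
  funext x; unfold pd; rw [fderiv_fun_sub (h.da x) (k.da x)]; rfl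
lemma pd_mul {f g : (Fin n → ℝ) → ℝ} (h : Sm f) (k : Sm g) (i : Fin n) :
    pd i (fun x => f x * g x) = fun x => pd i f x * g x + f x * pd i g x := by
  funext x; unfold pd; rw [fderiv_fun_mul (h.da x) (k.da x)]; simp; ring
lemma pd_const (c : ℝ) (i : Fin n) : pd i (fun _ => c) = fun _ => 0 := by
  funext x; unfold pd; simp
lemma pd_sum {f : Fin n → (Fin n → ℝ) → ℝ} (h : ∀ i, Sm (f i)) (i : Fin n) :
    pd i (fun x => ∑ j, f j x) = fun x => ∑ j, pd i (f j) x := by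
  funext x; unfold pd; rw [fderiv_fun_sum (fun j _ => (h j).da x)]; simp
lemma pd_coord (i k : Fin n) : pd k (fun x : Fin n → ℝ => x i) = fun _ => if k = i then 1 else 0 := by
  funext x; unfold pd
  have : fderiv ℝ (fun x : Fin n → ℝ => x i) x = ContinuousLinearMap.proj i :=
    (ContinuousLinearMap.proj (R := ℝ) (φ := fun _ : Fin n => ℝ) i).fderiv
  rw [this]; simp [Pi.single_apply, eq_comm]
lemma pd_comm {f : (Fin n → ℝ) → ℝ} (h : Sm f) (i j : Fin n) : pd i (pd j f) = pd j (pd i f) := by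
  funext x
  have hs : IsSymmSndFDerivAt ℝ f x :=
    ContDiffAt.isSymmSndFDerivAt (n := (⊤ : ℕ∞)) (ContDiff.contDiffAt h)
      (by simp only [minSmoothness_of_isRCLikeNormedField]; exact WithTop.coe_le_coe.2 (le_top : (2 : ℕ∞) ≤ ⊤))
  have h1 : ContDiff ℝ (⊤ : ℕ∞) (fderiv ℝ f) := ContDiff.fderiv_right h (by simp)
  have h2 := (h1.differentiable (by simp)) x
  have key : ∀ u v : Fin n → ℝ, fderiv ℝ (fun y => fderiv ℝ f y u) x v = fderiv ℝ (fderiv ℝ f) x v u := by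
    intro u v
    rw [fderiv_clm_apply h2 (by fun_prop)]; simp
  unfold pd
  rw [key, key]; exact hs _ _

/-- the structure of projective fields -/
def Proj (X : Fin n → (Fin n → ℝ) → ℝ) (c : Fin n → ℝ) : Prop :=
  (∀ m, Sm (X m)) ∧ ∀ k l m, pd l (pd k (X m)) =
    fun _ => (if l = m then c k else 0) + (if k = m then c l else 0)

lemma proj_of_span {X : Fin n → (Fin n → ℝ) → ℝ} (hX : X ∈ Submodule.span ℝ (projGenSm n)) :
    ∃ c, Proj X c := by
  induction hX using Submodule.span_induction with
  | mem X h =>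
    rcases h with (⟨i, rfl⟩ | ⟨p, rfl⟩) | ⟨i, rfl⟩
    · refine ⟨fun _ => 0, fun m => Sm.const _, fun k l m => ?_⟩
      simp [pd_const]
    · refine ⟨fun _ => 0, fun m => ?_, fun k l m => ?_⟩
      · by_cases h : m = p.2
        · simp only [h, if_true]; exact Sm.coord _
        · simp only [h, if_false]; exact Sm.const _
      · by_cases h : m = p.2
        · simp [h, pd_coord, pd_const]
        · simp [h, pd_const]
    · refine ⟨fun k => if k = i then 1 else 0, fun m => (Sm.coord i).mul (Sm.coord m), fun k l m => ?_⟩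
      simp only [pd_mul (Sm.coord i) (Sm.coord m), pd_coord]
      rw [pd_add ((Sm.const _).mul (Sm.coord m)) ((Sm.coord i).mul (Sm.const _)),
        pd_mul (Sm.const _) (Sm.coord m), pd_mul (Sm.coord i) (Sm.const _)]
      simp only [pd_coord, pd_const]
      funext x
      split_ifs <;> simp
  | zero => exact ⟨fun _ => 0, fun m => Sm.const 0, fun k l m => by
      have : (0 : Fin n → (Fin n → ℝ) → ℝ) m = fun _ => 0 := rfl
      rw [this]; simp [pd_const]⟩
  | add X Y _ _ hx hy =>
    obtain ⟨c, h1, h2⟩ := hx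
    obtain ⟨d, h3, h4⟩ := hy
    refine ⟨fun k => c k + d k, fun m => (h1 m).add (h3 m), fun k l m => ?_⟩
    have : (X + Y) m = fun x => X m x + Y m x := rfl
    rw [this, pd_add (h1 m) (h3 m), pd_add ((h1 m).pd k) ((h3 m).pd k), h2, h4]
    funext x
    split_ifs <;> ring
  | smul a X _ hx =>
    obtain ⟨c, h1, h2⟩ := hx
    refine ⟨fun k => a * c k, fun m => (Sm.const a).mul (h1 m), fun k l m => ?_⟩
    have : (a • X) m = fun x => a * X m x := rfl
    rw [this, pd_mul (Sm.const a) (h1 m)]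
    simp only [pd_const, zero_mul, zero_add]
    rw [pd_mul (Sm.const a) ((h1 m).pd k), h2]
    simp only [pd_const, zero_mul, zero_add]
    funext x
    split_ifs <;> ring

/-- transport along X -/
noncomputable def V (X : Fin n → (Fin n → ℝ) → ℝ) (f : (Fin n → ℝ) → ℝ) : (Fin n → ℝ) → ℝ :=
  fun x => ∑ k, X k x * pd k f x

variable {X : Fin n → (Fin n → ℝ) → ℝ} {c : Fin n → ℝ}

lemma Sm.V {f : (Fin n → ℝ) → ℝ} (hX : Proj X c) (h : Sm f) : Sm (V X f) :=
  Sm.sum fun k => (hX.1 k).mul (h.pd k)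

lemma V_add {f g : (Fin n → ℝ) → ℝ} (h : Sm f) (k : Sm g) :
    V X (fun x => f x + g x) = fun x => V X f x + V X g x := by
  funext x; simp only [V, pd_add h k, mul_add, Finset.sum_add_distrib]
lemma V_mul {f g : (Fin n → ℝ) → ℝ} (h : Sm f) (k : Sm g) :
    V X (fun x => f x * g x) = fun x => V X f x * g x + f x * V X g x := by
  funext x; simp only [V, pd_mul h k, mul_add, Finset.sum_add_distrib, Finset.sum_mul, Finset.mul_sum]
  congr 1 <;> exact Finset.sum_congr rfl fun _ _ => by ring
lemma V_const (a : ℝ) : V X (fun _ => a) = fun _ => 0 := by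
  funext x; simp [V, pd_const]
lemma V_sum {f : Fin n → (Fin n → ℝ) → ℝ} (h : ∀ i, Sm (f i)) :
    V X (fun x => ∑ j, f j x) = fun x => ∑ j, V X (f j) x := by
  funext x; simp only [V, pd_sum h, Finset.mul_sum]; rw [Finset.sum_comm]

lemma pd_V (hX : Proj X c) {f : (Fin n → ℝ) → ℝ} (h : Sm f) (l : Fin n) :
    pd l (V X f) = fun x => V X (pd l f) x + ∑ k, pd l (X k) x * pd k f x := by
  unfold V
  rw [pd_sum (fun k => (hX.1 k).mul (h.pd k))]
  funext x
  rw [← Finset.sum_add_distrib]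
  refine Finset.sum_congr rfl fun k _ => ?_
  rw [pd_mul (hX.1 k) (h.pd k), pd_comm h l k]
  ring

noncomputable def Dv (X : Fin n → (Fin n → ℝ) → ℝ) : (Fin n → ℝ) → ℝ := fun x => ∑ i, pd i (X i) x

lemma Dv_sm (hX : Proj X c) : Sm (Dv X) := Sm.sum fun k => (hX.1 k).pd k

lemma pd_Dv (hX : Proj X c) (l : Fin n) : pd l (Dv X) = fun _ => (n + 1) * c l := by
  unfold Dv
  rw [pd_sum (fun k => (hX.1 k).pd k)]
  funext x
  simp only [hX.2]
  simp [Finset.sum_add_distrib]; ring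

noncomputable def Gd (g : Fin n → Fin n → (Fin n → ℝ) → ℝ) (i : Fin n) : (Fin n → ℝ) → ℝ :=
  fun x => ∑ j, pd j (g i j) x

lemma Gd_sm {g : Fin n → Fin n → (Fin n → ℝ) → ℝ} (hg : ∀ i j, Sm (g i j)) (i) : Sm (Gd g i) :=
  Sm.sum fun j => (hg i j).pd j

lemma lieDer_eq (g : Fin n → Fin n → (Fin n → ℝ) → ℝ) (i j) : lieDer X g i j =
    fun x => V X (g i j) x - (∑ k, g k j x * pd k (X i) x) - ∑ k, g i k x * pd k (X j) x := by
  funext x; simp only [lieDer, V, Finset.sum_sub_distrib]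

lemma lieDer_sm (hX : Proj X c) {g : Fin n → Fin n → (Fin n → ℝ) → ℝ} (hg : ∀ i j, Sm (g i j)) (i j) :
    Sm (lieDer X g i j) := by
  rw [lieDer_eq]
  exact (((hg i j).V hX).sub (Sm.sum fun k => (hg k j).mul ((hX.1 i).pd k))).sub
    (Sm.sum fun k => (hg i k).mul ((hX.1 j).pd k))

lemma Gd_lieDer (hX : Proj X c) {g : Fin n → Fin n → (Fin n → ℝ) → ℝ} (hg : ∀ i j, Sm (g i j))
    (hsym : ∀ i j, g i j = g j i) (i : Fin n) :
    Gd (lieDer X g) i = fun x => V X (Gd g i) x - (∑ k, Gd g k x * pd k (X i) x)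
      - (n + 3) * ∑ k, c k * g i k x := by
  funext x
  have e : ∀ j, pd j (lieDer X g i j) x = V X (pd j (g i j)) x + (∑ k, pd j (X k) x * pd k (g i j) x)
      - (∑ k, pd j (g k j) x * pd k (X i) x) - ((if j = i then ∑ k, c k * g k j x else 0) + c j * g i j x)
      - (∑ k, pd j (g i k) x * pd k (X j) x) - (∑ k, c k * g i k x) - c j * g i j x := by
    intro j
    rw [lieDer_eq, pd_sub (((hg i j).V hX).sub (Sm.sum fun k => (hg k j).mul ((hX.1 i).pd k)))
      (Sm.sum fun k => (hg i k).mul ((hX.1 j).pd k)),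
      pd_sub ((hg i j).V hX) (Sm.sum fun k => (hg k j).mul ((hX.1 i).pd k)),
      pd_sum (fun k => (hg k j).mul ((hX.1 i).pd k)), pd_sum (fun k => (hg i k).mul ((hX.1 j).pd k)),
      pd_V hX (hg i j)]
    simp only [pd_mul (hg _ _) ((hX.1 _).pd _), hX.2, Finset.sum_add_distrib, mul_add]
    simp only [mul_ite, mul_zero, Finset.sum_ite_eq', Finset.mem_univ, if_true, mul_comm (g _ _ x) (c _)]
    split_ifs <;> (try simp only [Finset.sum_const_zero]) <;> ring
  have e2 : (∑ j, ∑ k, pd j (g i k) x * pd k (X j) x) = ∑ j, ∑ k, pd j (X k) x * pd k (g i j) x := by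
    rw [Finset.sum_comm]
    exact Finset.sum_congr rfl fun _ _ => Finset.sum_congr rfl fun _ _ => by ring
  have e3 : (∑ j, ∑ k, pd j (g k j) x * pd k (X i) x) = ∑ k, Gd g k x * pd k (X i) x := by
    rw [Finset.sum_comm]; simp only [Gd, Finset.sum_mul]
  have e4 : V X (Gd g i) x = ∑ j, V X (pd j (g i j)) x := by
    unfold Gd; rw [V_sum fun j => (hg i j).pd j]
  have e5 : (∑ k, c k * g k i x) = ∑ k, c k * g i k x :=
    Finset.sum_congr rfl fun k _ => by rw [hsym]
  rw [e4, ← e3]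
  conv_lhs => unfold Gd
  simp only [e, Finset.sum_sub_distrib, Finset.sum_add_distrib, e2]
  simp [e5]
  ring

lemma GGd_lieDer (hX : Proj X c) {g : Fin n → Fin n → (Fin n → ℝ) → ℝ} (hg : ∀ i j, Sm (g i j))
    (hsym : ∀ i j, g i j = g j i) (x) :
    ∑ i, pd i (Gd (lieDer X g) i) x = V X (fun x => ∑ i, pd i (Gd g i) x) x
      - (2 * n + 4) * ∑ k, c k * Gd g k x := by
  have hG := Gd_sm hg
  have e : ∀ i, pd i (Gd (lieDer X g) i) x = V X (pd i (Gd g i)) x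
      + (∑ k, pd i (X k) x * pd k (Gd g i) x) - (∑ k, pd i (Gd g k) x * pd k (X i) x)
      - (∑ k, c k * Gd g k x) - c i * Gd g i x - (n + 3) * ∑ k, c k * pd i (g i k) x := by
    intro i
    have s1 : Sm (fun x => ∑ k, Gd g k x * pd k (X i) x) := Sm.sum fun k => (hG k).mul ((hX.1 i).pd k)
    have s2 : Sm (fun x => ∑ k, c k * g i k x) := Sm.sum fun k => (Sm.const _).mul (hg i k)
    rw [Gd_lieDer hX hg hsym, pd_sub (((hG i).V hX).sub s1) ((Sm.const _).mul s2),
      pd_sub ((hG i).V hX) s1, pd_mul (Sm.const _) s2,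
      pd_sum (fun k => (hG k).mul ((hX.1 i).pd k)), pd_sum (fun k => (Sm.const _).mul (hg i k)),
      pd_V hX (hG i)]
    simp only [pd_mul (hG _) ((hX.1 _).pd _), pd_mul (Sm.const _) (hg _ _), pd_const, hX.2,
      Finset.sum_add_distrib, mul_add]
    simp [mul_comm _ (c _)]
    ring
  have e2 : (∑ j, ∑ k, pd j (Gd g k) x * pd k (X j) x) = ∑ j, ∑ k, pd j (X k) x * pd k (Gd g j) x := by
    rw [Finset.sum_comm]
    exact Finset.sum_congr rfl fun _ _ => Finset.sum_congr rfl fun _ _ => by ring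
  have e3 : (∑ i, ∑ k, c k * pd i (g i k) x) = ∑ k, c k * Gd g k x := by
    rw [Finset.sum_comm]; simp only [Gd, Finset.mul_sum]
    exact Finset.sum_congr rfl fun k _ => Finset.sum_congr rfl fun i _ => by rw [hsym]
  rw [V_sum fun i => (hG i).pd i]
  simp only [e, Finset.sum_sub_distrib, Finset.sum_add_distrib, e2, ← Finset.mul_sum, e3]
  simp
  ring

lemma pd_half (hX : Proj X c) {f : (Fin n → ℝ) → ℝ} (h : Sm f) (i : Fin n) :
    pd i (halfDensAct X f) = fun x => V X (pd i f) x + (∑ k, pd i (X k) x * pd k f x)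
      + 1 / 2 * Dv X x * pd i f x + (n + 1) / 2 * c i * f x := by
  have : halfDensAct X f = fun x => V X f x + 1 / 2 * Dv X x * f x := rfl
  have hD := Dv_sm hX
  rw [this, pd_add (h.V hX) (((Sm.const _).mul hD).mul h), pd_mul ((Sm.const _).mul hD) h,
    pd_mul (Sm.const _) hD, pd_V hX h, pd_Dv hX]
  funext x
  simp only [pd_const]
  ring

lemma pd_pd_half (hX : Proj X c) {f : (Fin n → ℝ) → ℝ} (h : Sm f) (i j : Fin n) (x) :
    pd i (pd j (halfDensAct X f)) x = V X (pd i (pd j f)) x + (∑ k, pd i (X k) x * pd k (pd j f) x)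
      + (∑ k, pd j (X k) x * pd k (pd i f) x)
      + 1 / 2 * Dv X x * pd i (pd j f) x + (n + 3) / 2 * (c i * pd j f x + c j * pd i f x) := by
  have hD := Dv_sm hX
  have s1 : Sm (fun x => ∑ k, pd j (X k) x * pd k f x) := Sm.sum fun k => ((hX.1 k).pd j).mul (h.pd k)
  have s2 : Sm (fun x => 1 / 2 * Dv X x * pd j f x) := ((Sm.const _).mul hD).mul (h.pd j)
  have s0 := (h.pd j).V hX
  rw [pd_half hX h, pd_add ((s0.add s1).add s2) ((Sm.const _).mul h), pd_add (s0.add s1) s2,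
    pd_add s0 s1, pd_V hX (h.pd j), pd_sum (fun k => ((hX.1 k).pd j).mul (h.pd k)),
    pd_mul ((Sm.const _).mul hD) (h.pd j), pd_mul (Sm.const _) hD, pd_mul (Sm.const _) h, pd_Dv hX]
  simp only [pd_mul ((hX.1 _).pd _) (h.pd _), pd_const, hX.2, Finset.sum_add_distrib, add_mul,
    pd_comm h i]
  simp
  ring

lemma Qproj_eq (ℏ : ℝ) {g : Fin n → Fin n → (Fin n → ℝ) → ℝ} (hg : ∀ i j, Sm (g i j)) (f) :
    Qproj ℏ g f = fun x => -ℏ ^ 2 * ((∑ i, ∑ j, g i j x * pd i (pd j f) x)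
      + (∑ i, Gd g i x * pd i f x)
      + ((n + 1) / (4 * (n + 2))) * (∑ i, pd i (Gd g i) x) * f x) := by
  funext x
  unfold Qproj Gd
  simp only [Finset.sum_mul, pd_sum (fun j => (hg _ j).pd j)]

lemma V_Q (ℏ : ℝ) {g : Fin n → Fin n → (Fin n → ℝ) → ℝ} (hg : ∀ i j, Sm (g i j)) {f} (h : Sm f) (x) :
    V X (Qproj ℏ g f) x = -ℏ ^ 2 * ((∑ i, ∑ j, V X (g i j) x * pd i (pd j f) x)
      + (∑ i, ∑ j, g i j x * V X (pd i (pd j f)) x)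
      + (∑ i, V X (Gd g i) x * pd i f x) + (∑ i, Gd g i x * V X (pd i f) x)
      + ((n + 1) / (4 * (n + 2))) * V X (fun x => ∑ i, pd i (Gd g i) x) x * f x
      + ((n + 1) / (4 * (n + 2))) * (∑ i, pd i (Gd g i) x) * V X f x) := by
  have hG := Gd_sm hg
  have a1 : ∀ i j, Sm (fun x => g i j x * pd i (pd j f) x) := fun i j => (hg i j).mul ((h.pd j).pd i)
  have a2 : ∀ i, Sm (fun x => ∑ j, g i j x * pd i (pd j f) x) := fun i => Sm.sum (a1 i)
  have b1 : ∀ i, Sm (fun x => Gd g i x * pd i f x) := fun i => (hG i).mul (h.pd i)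
  have c1 : Sm (fun x => ∑ i, pd i (Gd g i) x) := Sm.sum fun i => (hG i).pd i
  have c2 : Sm (fun x => ((n + 1) / (4 * (n + 2)) : ℝ) * (∑ i, pd i (Gd g i) x)) := (Sm.const _).mul c1
  rw [Qproj_eq ℏ hg, V_mul (Sm.const _) (((Sm.sum a2).add (Sm.sum b1)).add (c2.mul h)),
    V_add ((Sm.sum a2).add (Sm.sum b1)) (c2.mul h), V_add (Sm.sum a2) (Sm.sum b1),
    V_mul c2 h, V_mul (Sm.const _) c1, V_sum a2, V_sum b1]
  simp only [V_sum (a1 _), V_mul (hg _ _) ((h.pd _).pd _), V_mul (hG _) (h.pd _), V_const,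
    Finset.sum_add_distrib]
  ring

end



/-- Projective equivariance of the quantization `Q` of quadratic symbols at weights
`λ = μ = 1/2`: for every `X` in the span of the projective generators,
`Q(L_X g) = ℓ_X ∘ Q(g) − Q(g) ∘ ℓ_X` on smooth functions. -/
theorem stmt6 (n : ℕ) (hn : 1 ≤ n) (ℏ : ℝ)
    (g : Fin n → Fin n → (Fin n → ℝ) → ℝ)
    (hg : ∀ i j, ContDiff ℝ (⊤ : ℕ∞) (g i j)) (hsym : ∀ i j, g i j = g j i)
    (Xv : Fin n → (Fin n → ℝ) → ℝ) (hX : Xv ∈ Submodule.span ℝ (projGenSm n))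
    (f : (Fin n → ℝ) → ℝ) (hf : ContDiff ℝ (⊤ : ℕ∞) f) (x : Fin n → ℝ) :
    Qproj ℏ (lieDer Xv g) f x
      = halfDensAct Xv (Qproj ℏ g f) x - Qproj ℏ g (halfDensAct Xv f) x := by
  obtain ⟨c, hP⟩ := proj_of_span hX
  have hh := lieDer_sm hP hg
  have hG := Gd_sm hg
  have r1 : halfDensAct Xv (Qproj ℏ g f) x
      = V Xv (Qproj ℏ g f) x + 1 / 2 * Dv Xv x * Qproj ℏ g f x := rfl
  rw [r1, V_Q ℏ hg hf, Qproj_eq ℏ hh, Qproj_eq ℏ hg f, Qproj_eq ℏ hg]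
  beta_reduce
  rw [GGd_lieDer hP hg hsym]
  simp only [pd_pd_half hP hf]
  simp only [pd_half hP hf, Gd_lieDer hP hg hsym, lieDer_eq]
  have r2 : halfDensAct Xv f x = V Xv f x + 1 / 2 * Dv Xv x * f x := rfl
  rw [r2]
  -- second order terms
  have t1 : ∑ i, ∑ j, (V Xv (g i j) x - (∑ k, g k j x * pd k (Xv i) x)
        - ∑ k, g i k x * pd k (Xv j) x) * pd i (pd j f) x
      = (∑ i, ∑ j, V Xv (g i j) x * pd i (pd j f) x)
        - (∑ i, ∑ j, g i j x * ∑ k, pd i (Xv k) x * pd k (pd j f) x)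
        - (∑ i, ∑ j, g i j x * ∑ k, pd j (Xv k) x * pd k (pd i f) x) := by
    simp only [sub_mul, Finset.sum_sub_distrib]
    congr 1
    · congr 1
      simp only [Finset.sum_mul, Finset.mul_sum]
      rw [Finset.sum_comm]
      conv_rhs => rw [Finset.sum_comm]
      refine Finset.sum_congr rfl fun j _ => ?_
      rw [Finset.sum_comm]
      exact Finset.sum_congr rfl fun _ _ => Finset.sum_congr rfl fun _ _ => by ring
    · simp only [Finset.sum_mul, Finset.mul_sum]
      refine Finset.sum_congr rfl fun j _ => ?_
      rw [Finset.sum_comm]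
      exact Finset.sum_congr rfl fun k _ => Finset.sum_congr rfl fun l _ => by
        rw [pd_comm hf j l]; ring
  have t2 : ∑ i, (V Xv (Gd g i) x - (∑ k, Gd g k x * pd k (Xv i) x)
        - (n + 3) * ∑ k, c k * g i k x) * pd i f x
      = (∑ i, V Xv (Gd g i) x * pd i f x) - (∑ i, Gd g i x * ∑ k, pd i (Xv k) x * pd k f x)
        - (n + 3) * ∑ i, ∑ j, g i j x * (c j * pd i f x) := by
    simp only [sub_mul, Finset.sum_sub_distrib]
    congr 1
    · congr 1
      simp only [Finset.sum_mul, Finset.mul_sum]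
      rw [Finset.sum_comm]
      exact Finset.sum_congr rfl fun _ _ => Finset.sum_congr rfl fun _ _ => by ring
    · simp only [Finset.sum_mul, Finset.mul_sum]
      exact Finset.sum_congr rfl fun _ _ => Finset.sum_congr rfl fun _ _ => by ring
  have t3 : ∑ i, ∑ j, g i j x * (c i * pd j f x) = ∑ i, ∑ j, g i j x * (c j * pd i f x) := by
    rw [Finset.sum_comm]
    exact Finset.sum_congr rfl fun i _ => Finset.sum_congr rfl fun j _ => by rw [hsym]
  have p1 : ∀ a : ℝ, ∀ F : Fin n → Fin n → ℝ, ∑ i, ∑ j, g i j x * (a * F i j)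
      = a * ∑ i, ∑ j, g i j x * F i j := by
    intro a F
    simp only [Finset.mul_sum]
    exact Finset.sum_congr rfl fun _ _ => Finset.sum_congr rfl fun _ _ => by ring
  have p2 : ∀ a : ℝ, ∀ F : Fin n → ℝ, ∑ i, Gd g i x * (a * F i) = a * ∑ i, Gd g i x * F i := by
    intro a F
    simp only [Finset.mul_sum]
    exact Finset.sum_congr rfl fun _ _ => by ring
  have p3 : ∑ i, Gd g i x * ((n + 1) / 2 * c i * f x) = (n + 1) / 2 * f x * ∑ i, c i * Gd g i x := by
    simp only [Finset.mul_sum]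
    exact Finset.sum_congr rfl fun _ _ => by ring
  have p4 : ∑ i, ∑ j, g i j x * ((n + 3) / 2 * (c i * pd j f x + c j * pd i f x))
      = (n + 3) * ∑ i, ∑ j, g i j x * (c j * pd i f x) := by
    rw [p1]
    simp only [mul_add, Finset.sum_add_distrib, t3]
    ring
  rw [t1, t2]
  have q1 : ∀ A B C D E : Fin n → Fin n → ℝ, ∑ i, ∑ j, g i j x * (A i j + B i j + C i j + D i j + E i j)
      = (∑ i, ∑ j, g i j x * A i j) + (∑ i, ∑ j, g i j x * B i j) + (∑ i, ∑ j, g i j x * C i j)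
      + (∑ i, ∑ j, g i j x * D i j) + (∑ i, ∑ j, g i j x * E i j) := by
    intros; simp only [mul_add, Finset.sum_add_distrib]
  have q2 : ∀ A B C D : Fin n → ℝ, ∑ i, Gd g i x * (A i + B i + C i + D i)
      = (∑ i, Gd g i x * A i) + (∑ i, Gd g i x * B i) + (∑ i, Gd g i x * C i)
      + (∑ i, Gd g i x * D i) := by
    intros; simp only [mul_add, Finset.sum_add_distrib]
  rw [q1, q2, p4, p3, p1, p2]
  have hn2 : ((n : ℝ) + 2) ≠ 0 := by positivity
  field_simp
  ring
end

section
/- Let p, q ≥ 0 with n = p + q ≥ 2, let η = diag(1, …, 1, −1, …, −1) be the flat metric of signature (p, q) on ℝ^n, write x_i = η_{ij} x^j, and let ℏ ∈ ℝ. For a smooth symmetric contravariant 2-tensor field g^{ij} on ℝ^n, define the operator Q(g) acting on smooth functions f : ℝ^n → ℝ by Q(g) f = −ℏ² ( g^{ij} ∂_i ∂_j f + (∂_j g^{ij}) ∂_i f + (n/(4(n+1))) (∂_i ∂_j g^{ij}) f + (n/(4(n+1)(n+2))) η^{kl} ∂_k ∂_l (η_{ij} g^{ij}) f ). Then for every X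 in the linear span of the conformal generators ∂_i, x_i ∂_j − x_j ∂_i, E = x^j ∂_j, x_j x^j ∂_i − 2 x_i E, one has Q(L_X g) = ℓ_X ∘ Q(g) − Q(g) ∘ ℓ_X as operators on smooth functions on ℝ^n, where (L_X g)^{ij} = X^k ∂_k g^{ij} − g^{kj} ∂_k X^i − g^{ik} ∂_k X^j and ℓ_X f = X^i ∂_i f + (1/2)(∂_i X^i) f. -/
set_option maxHeartbeats 1000000

/-- The conformal generators on ℝⁿ, `n = p + q`, viewed as vector fields:
translations `∂ᵢ`, rotations `xᵢ∂ⱼ − xⱼ∂ᵢ`, the Euler field `E = xʲ∂ⱼ`, and the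
inversions `xⱼxʲ∂ᵢ − 2xᵢE`, where `xᵢ = ηᵢⱼxʲ`. -/
def confGenSm (p q : ℕ) : Set (Fin (p + q) → (Fin (p + q) → ℝ) → ℝ) :=
  (Set.range fun i : Fin (p + q) =>
    fun m (_ : Fin (p + q) → ℝ) => if m = i then (1 : ℝ) else 0) ∪
  (Set.range fun pr : Fin (p + q) × Fin (p + q) =>
    fun m (x : Fin (p + q) → ℝ) =>
      (if m = pr.2 then etaSgn p q pr.1 * x pr.1 else 0)
        - (if m = pr.1 then etaSgn p q pr.2 * x pr.2 else 0)) ∪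
  {fun m (x : Fin (p + q) → ℝ) => x m} ∪
  (Set.range fun i : Fin (p + q) =>
    fun m (x : Fin (p + q) → ℝ) =>
      (if m = i then ∑ j, etaSgn p q j * x j * x j else 0)
        - 2 * (etaSgn p q i * x i) * x m)

/-- The conformally equivariant quantization of the quadratic symbol `g^{ij} ξᵢ ξⱼ`
at weights `λ = μ = 1/2`:
`Q(g)f = −ℏ²(g^{ij}∂ᵢ∂ⱼf + (∂ⱼg^{ij})∂ᵢf + (n/(4(n+1)))(∂ᵢ∂ⱼg^{ij})f
 + (n/(4(n+1)(n+2))) η^{kl}∂_k∂_l(η_{ij}g^{ij}) f)`. -/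
noncomputable def Qconf (p q : ℕ) (ℏ : ℝ)
    (g : Fin (p + q) → Fin (p + q) → (Fin (p + q) → ℝ) → ℝ)
    (f : (Fin (p + q) → ℝ) → ℝ) : (Fin (p + q) → ℝ) → ℝ :=
  fun x => -ℏ ^ 2 * ((∑ i, ∑ j, g i j x * pd i (pd j f) x)
    + (∑ i, ∑ j, pd j (g i j) x * pd i f x)
    + (((p + q : ℕ) : ℝ) / (4 * ((p + q : ℕ) + 1))) * (∑ i, ∑ j, pd i (pd j (g i j)) x) * f x
    + (((p + q : ℕ) : ℝ) / (4 * ((p + q : ℕ) + 1) * ((p + q : ℕ) + 2)))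
        * (∑ k, etaSgn p q k * pd k (pd k (fun y => ∑ i, etaSgn p q i * g i i y)) x) * f x)


section abstractPart
variable {S : Type*} [CommRing S] [Algebra ℝ S] {n : ℕ}

theorem tri_swap13 (H : Fin n → Fin n → Fin n → S) :
    ∑ i, ∑ j, ∑ k, H k j i = ∑ i, ∑ j, ∑ k, H i j k := by
  rw [Finset.sum_comm]
  conv_rhs => rw [Finset.sum_comm]
  exact Finset.sum_congr rfl fun j _ => Finset.sum_comm

theorem tri_swap23 (H : Fin n → Fin n → Fin n → S) :
    ∑ i, ∑ j, ∑ k, H i k j = ∑ i, ∑ j, ∑ k, H i j k :=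
  Finset.sum_congr rfl fun j _ => Finset.sum_comm

def aLie (d : Fin n → Derivation ℝ S S) (X : Fin n → S) (g : Fin n → Fin n → S) :
    Fin n → Fin n → S :=
  fun i j => ∑ k, (X k * d k (g i j) - g k j * d k (X i) - g i k * d k (X j))

def aV (d : Fin n → Derivation ℝ S S) (X : Fin n → S) (f : S) : S := ∑ k, X k * d k f

def aP (d : Fin n → Derivation ℝ S S) (g : Fin n → Fin n → S) (f : S) : S :=
  (∑ i, ∑ j, g i j * d i (d j f)) + (∑ i, ∑ j, d j (g i j) * d i f)

def aDD (d : Fin n → Derivation ℝ S S) (g : Fin n → Fin n → S) : S :=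
  ∑ i, ∑ j, d i (d j (g i j))

def aBox (d : Fin n → Derivation ℝ S S) (e : Fin n → S) (t : S) : S :=
  ∑ k, e k * d k (d k t)

def aTr (e : Fin n → S) (g : Fin n → Fin n → S) : S := ∑ i, e i * g i i

theorem aP_lie (d : Fin n → Derivation ℝ S S) (hc : ∀ i j x, d i (d j x) = d j (d i x))
    (g : Fin n → Fin n → S) (X : Fin n → S) (f : S) :
    aP d (aLie d X g) f = aV d X (aP d g f) - aP d g (aV d X f)
      - ∑ i, ∑ j, g i j * d j (∑ k, d k (X k)) * d i f := by
  have h1 := tri_swap13 fun i j k => g i j * d i (X k) * d j (d k f)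
  have h2 := tri_swap23 fun i j k => g i j * d j (X k) * d i (d k f)
  have h3 := tri_swap13 fun i j k => d j (g i j) * d i (X k) * d k f
  have h4 := tri_swap13 fun i j k => g i j * d i (d j (X k)) * d k f
  have h5 := tri_swap23 fun i j k => d k (g i j) * d j (X k) * d i f
  have h6 := tri_swap23 fun i j k => g i j * d j (d k (X k)) * d i f
  have h6 := tri_swap23 fun i j k => g i j * d j (d k (X k)) * d i f
  have e1 : aV d X (aP d g f) = ∑ i, ∑ j, ∑ k, X k * d k (g i j * d i (d j f) + d j (g i j) * d i f) := by
    unfold aV aP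
    simp only [map_add, map_sum, Finset.mul_sum, ← Finset.sum_add_distrib, mul_add]
    rw [Finset.sum_comm]
    exact Finset.sum_congr rfl fun j _ => Finset.sum_comm
  have key : aP d (aLie d X g) f - (aV d X (aP d g f) - aP d g (aV d X f)
      - ∑ i, ∑ j, g i j * d j (∑ k, d k (X k)) * d i f)
      + (∑ i, ∑ j, ∑ k, g k j * d k (X i) * d j (d i f) - ∑ i, ∑ j, ∑ k, g i j * d i (X k) * d j (d k f))
      + (∑ i, ∑ j, ∑ k, g i k * d k (X j) * d i (d j f) - ∑ i, ∑ j, ∑ k, g i j * d j (X k) * d i (d k f))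
      + (∑ i, ∑ j, ∑ k, d j (g k j) * d k (X i) * d i f - ∑ i, ∑ j, ∑ k, d j (g i j) * d i (X k) * d k f)
      + (∑ i, ∑ j, ∑ k, g k j * d k (d j (X i)) * d i f - ∑ i, ∑ j, ∑ k, g i j * d i (d j (X k)) * d k f)
      + (∑ i, ∑ j, ∑ k, d j (g i k) * d k (X j) * d i f - ∑ i, ∑ j, ∑ k, d k (g i j) * d j (X k) * d i f)
      + (∑ i, ∑ j, ∑ k, g i k * d k (d j (X j)) * d i f - ∑ i, ∑ j, ∑ k, g i j * d j (d k (X k)) * d i f)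
      = 0 := by
    rw [e1]
    unfold aP aV aLie
    simp only [map_sum, Finset.mul_sum, Finset.sum_mul, ← Finset.sum_add_distrib, ← Finset.sum_sub_distrib]
    refine Finset.sum_eq_zero fun i _ => Finset.sum_eq_zero fun j _ => Finset.sum_eq_zero fun k _ => ?_
    simp only [map_add, map_sub, Derivation.leibniz, smul_eq_mul, hc]
    ring
  rw [h1, h2, h3, h4, h5, h6] at key
  linear_combination key

theorem aP_mul (d : Fin n → Derivation ℝ S S) 
    (g : Fin n → Fin n → S) (hs : ∀ i j, g i j = g j i) (D f : S) (hD : ∀ i j, d i (d j D) = 0) :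
    aP d g (D * f) = D * aP d g f + 2 * ∑ i, ∑ j, g i j * d j D * d i f
      + (∑ i, ∑ j, d j (g i j) * d i D) * f := by
  have h : ∑ i, ∑ j, g j i * d i D * d j f = ∑ i, ∑ j, g i j * d j D * d i f := Finset.sum_comm
  have key : aP d g (D * f) - (D * aP d g f + 2 * ∑ i, ∑ j, g i j * d j D * d i f
      + (∑ i, ∑ j, d j (g i j) * d i D) * f) - 
      (∑ i, ∑ j, g j i * d i D * d j f - ∑ i, ∑ j, g i j * d j D * d i f) = 0 := by
    unfold aP
    simp only [mul_add, map_sum, Finset.mul_sum, Finset.sum_mul, ← Finset.sum_add_distrib, ← Finset.sum_sub_distrib]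
    refine Finset.sum_eq_zero fun i _ => Finset.sum_eq_zero fun j _ => ?_
    simp only [map_add, map_sub, Derivation.leibniz, smul_eq_mul, hD, hs j i]
    ring
  rw [h] at key
  linear_combination key

theorem aDD_lie (d : Fin n → Derivation ℝ S S) (hc : ∀ i j x, d i (d j x) = d j (d i x))
    (g : Fin n → Fin n → S) (hs : ∀ i j, g i j = g j i) (X : Fin n → S)
    (h3 : ∀ i j k l, d i (d j (d k (X l))) = 0) :
    aDD d (aLie d X g) = aV d X (aDD d g)
      - 2 * ∑ i, ∑ j, d j (g i j) * d i (∑ k, d k (X k))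
      - ∑ i, ∑ j, ∑ k, d i (d j (X k)) * d k (g i j) := by
  have e1 : aV d X (aDD d g) = ∑ i, ∑ j, ∑ k, X k * d k (d i (d j (g i j))) := by
    unfold aV aDD
    simp only [map_sum, Finset.mul_sum]
    rw [Finset.sum_comm]
    exact Finset.sum_congr rfl fun j _ => Finset.sum_comm
  -- terms produced by the two `g dX` parts
  have s1 := tri_swap13 fun i j k => d i (X k) * d k (d j (g i j))
  have s2 := tri_swap23 fun i j k => d j (X k) * d k (d i (g i j))
  have s3 := tri_swap13 fun i j k => d j (g i j) * d i (d k (X k))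
  have s4 := tri_swap13 fun i j k => d i (d j (X k)) * d k (g i j)
  have s5 := tri_swap23 fun i j k => d i (g i j) * d j (d k (X k))
  have s6 := tri_swap23 fun i j k => d i (d j (X k)) * d k (g i j)
  have s7 : ∑ i, ∑ j, ∑ k, d i (g i j) * d j (d k (X k))
      = ∑ i, ∑ j, ∑ k, d j (g i j) * d i (d k (X k)) := by
    rw [Finset.sum_comm]
    simp only [hs]
  have key : aDD d (aLie d X g) - (aV d X (aDD d g)
      - 2 * ∑ i, ∑ j, d j (g i j) * d i (∑ k, d k (X k))
      - ∑ i, ∑ j, ∑ k, d i (d j (X k)) * d k (g i j))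
      + (∑ i, ∑ j, ∑ k, d k (X i) * d i (d j (g k j)) - ∑ i, ∑ j, ∑ k, d i (X k) * d k (d j (g i j)))
      + (∑ i, ∑ j, ∑ k, d k (X j) * d j (d i (g i k)) - ∑ i, ∑ j, ∑ k, d j (X k) * d k (d i (g i j)))
      + (∑ i, ∑ j, ∑ k, d j (g k j) * d k (d i (X i)) - ∑ i, ∑ j, ∑ k, d j (g i j) * d i (d k (X k)))
      + (∑ i, ∑ j, ∑ k, d k (d j (X i)) * d i (g k j) - ∑ i, ∑ j, ∑ k, d i (d j (X k)) * d k (g i j))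
      + (∑ i, ∑ j, ∑ k, d i (g i k) * d k (d j (X j)) - ∑ i, ∑ j, ∑ k, d i (g i j) * d j (d k (X k)))
      + (∑ i, ∑ j, ∑ k, d i (d k (X j)) * d j (g i k) - ∑ i, ∑ j, ∑ k, d i (d j (X k)) * d k (g i j))
      + (∑ i, ∑ j, ∑ k, d i (g i j) * d j (d k (X k))
        - ∑ i, ∑ j, ∑ k, d j (g i j) * d i (d k (X k))) = 0 := by
    rw [e1]
    unfold aDD aLie
    simp only [map_sum, Finset.mul_sum, Finset.sum_mul, ← Finset.sum_add_distrib, ← Finset.sum_sub_distrib]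
    refine Finset.sum_eq_zero fun i _ => Finset.sum_eq_zero fun j _ => Finset.sum_eq_zero fun k _ => ?_
    simp only [map_add, map_sub, Derivation.leibniz, smul_eq_mul, h3]
    simp only [hc]
    ring
  rw [s1, s2, s3, s4, s5, s6, s7] at key
  linear_combination key

structure AConf (d : Fin n → Derivation ℝ S S) (e : Fin n → S) (X : Fin n → S) (φ : S)
    (v : Fin n → S) : Prop where
  dφ : ∀ i, d i φ = v i
  dv : ∀ i j, d i (v j) = 0
  conf : ∀ i j, e j * d i (X j) + e i * d j (X i) = if i = j then 2 * e i * φ else 0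
  snd : ∀ i j k, d i (d j (X k)) = (if k = i then v j else 0) + (if k = j then v i else 0)
    - (if i = j then e i * e k * v k else 0)
  dX : ∀ i, d i (X i) = φ

theorem aTr_lie (d : Fin n → Derivation ℝ S S) (e : Fin n → S)
    (g : Fin n → Fin n → S) (hs : ∀ i j, g i j = g j i) (X : Fin n → S) (φ : S) (v : Fin n → S)
    (he : ∀ i k, d i (e k) = 0) (hX : AConf d e X φ v) :
    aTr e (aLie d X g) = aV d X (aTr e g) - 2 * φ * aTr e g := by
  have h0 : 2 * φ * aTr e g = ∑ i, ∑ k, g i k * (e k * d i (X k) + e i * d k (X i)) := by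
    simp only [hX.conf, mul_ite, mul_zero, Finset.sum_ite_eq, Finset.mem_univ, if_true, aTr, Finset.mul_sum]
    exact Finset.sum_congr rfl fun i _ => by ring
  have h1 : aV d X (aTr e g) = ∑ i, ∑ k, X k * (e i * d k (g i i)) := by
    rw [Finset.sum_comm]
    simp only [aV, aTr, map_sum, Finset.mul_sum, Derivation.leibniz, he, smul_eq_mul, mul_zero, add_zero]
  have h2 : ∑ i, ∑ k, g k i * (e i * d k (X i)) = ∑ i, ∑ k, g i k * (e k * d i (X k)) :=
    Finset.sum_comm
  have key : aTr e (aLie d X g) - ∑ i, ∑ k, X k * (e i * d k (g i i))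
     + ∑ i, ∑ k, g i k * (e k * d i (X k) + e i * d k (X i)) 
     + (∑ i, ∑ k, g k i * (e i * d k (X i)) - ∑ i, ∑ k, g i k * (e k * d i (X k))) = 0 := by
    unfold aTr aLie
    simp only [Finset.mul_sum, ← Finset.sum_add_distrib, ← Finset.sum_sub_distrib]
    refine Finset.sum_eq_zero fun i _ => Finset.sum_eq_zero fun k _ => ?_
    ring
  rw [h0, h1]
  rw [h2] at key
  linear_combination key

theorem aBox_lie (d : Fin n → Derivation ℝ S S) (hc : ∀ i j x, d i (d j x) = d j (d i x))
    (e : Fin n → S) (X : Fin n → S) (φ : S) (v : Fin n → S) (t : S)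
    (he : ∀ i k, d i (e k) = 0) (hee : ∀ i, e i * e i = 1) (hX : AConf d e X φ v) :
    aBox d e (aV d X t - 2 * φ * t) = aV d X (aBox d e t) - (n + 2) * ∑ k, e k * v k * d k t := by
  have h2 : ∀ i, d i (2 : S) = 0 := fun i => by
    simpa using (d i).map_natCast 2
  have c' : ∀ i j, e i * d i (X j) + e j * d j (X i) = if i = j then 2 * e i * φ else 0 := by
    intro i j
    have h := hX.conf i j
    have : e i * d i (X j) + e j * d j (X i) =
        e i * e j * (e j * d i (X j) + e i * d j (X i)) := by
      linear_combination (- e i * d i (X j)) * hee j - e j * d j (X i) * hee i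
    rw [this, h]
    split_ifs with hij
    · subst hij; linear_combination (2 * e i * φ) * hee i
    · simp
  have h0 : 2 * φ * aBox d e t
      = ∑ k, ∑ m, (e k * d k (X m) + e m * d m (X k)) * d k (d m t) := by
    simp only [c', ite_mul, zero_mul, Finset.sum_ite_eq, Finset.mem_univ, if_true, aBox, Finset.mul_sum]
    exact Finset.sum_congr rfl fun i _ => by ring
  have h1 : ∑ k, ∑ m, e k * d k (d k (X m)) * d m t = (2 - n) * ∑ k, e k * v k * d k t := by
    rw [Finset.sum_comm, Finset.mul_sum]
    refine Finset.sum_congr rfl fun m _ => ?_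
    rw [← Finset.sum_mul]
    have : ∑ k, e k * d k (d k (X m)) = 2 * (e m * v m) - n * (e m * v m) := by
      simp only [hX.snd, if_true, mul_sub, mul_add, Finset.sum_sub_distrib, Finset.sum_add_distrib,
        mul_ite, mul_zero, Finset.sum_ite_eq, Finset.mem_univ, ← mul_assoc, hee, one_mul]
      simp
      ring
    rw [this]; ring
  have h3 : aV d X (aBox d e t) = ∑ k, ∑ m, X m * (e k * d m (d k (d k t))) := by
    rw [Finset.sum_comm]
    simp only [aV, aBox, map_sum, Finset.mul_sum, Derivation.leibniz, he, smul_eq_mul, mul_zero, add_zero]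
  have h4 : aBox d e (φ * t) = φ * aBox d e t + 2 * ∑ k, e k * v k * d k t := by
    simp only [aBox, Finset.mul_sum, ← Finset.sum_add_distrib]
    refine Finset.sum_congr rfl fun i _ => ?_
    simp only [map_add, Derivation.leibniz, smul_eq_mul, hX.dφ, hX.dv]
    ring
  have h5 : ∑ k, ∑ m, e m * d m (X k) * d k (d m t) = ∑ k, ∑ m, e k * d k (X m) * d k (d m t) := by
    rw [Finset.sum_comm]
    exact Finset.sum_congr rfl fun i _ => Finset.sum_congr rfl fun j _ => by rw [hc]
  have h6 : aBox d e (aV d X t) = ∑ k, ∑ m, e k * d k (d k (X m)) * d m t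
      + 2 * (∑ k, ∑ m, e k * d k (X m) * d k (d m t)) 
      + ∑ k, ∑ m, X m * (e k * d m (d k (d k t))) := by
    unfold aBox aV
    simp only [map_sum, Finset.mul_sum, ← Finset.sum_add_distrib]
    refine Finset.sum_congr rfl fun i _ => Finset.sum_congr rfl fun j _ => ?_
    simp only [map_add, Derivation.leibniz, smul_eq_mul, hc]
    ring
  have h7 : aBox d e (aV d X t - 2 * φ * t) = aBox d e (aV d X t) - 2 * aBox d e (φ * t) := by
    simp only [aBox, Finset.mul_sum, ← Finset.sum_sub_distrib]
    refine Finset.sum_congr rfl fun i _ => ?_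
    simp only [mul_assoc, map_sub, Derivation.leibniz (d i) 2, smul_eq_mul, h2, mul_zero, add_zero]
    ring
  simp only [add_mul, Finset.sum_add_distrib] at h0
  rw [h5] at h0
  rw [h7, h4, h6, h3, h1]
  linear_combination -h0

theorem aMain (d : Fin n → Derivation ℝ S S) (hc : ∀ i j x, d i (d j x) = d j (d i x))
    (e : Fin n → S) (g : Fin n → Fin n → S) (hs : ∀ i j, g i j = g j i)
    (X : Fin n → S) (φ : S) (v : Fin n → S) (f : S)
    (he : ∀ i k, d i (e k) = 0) (hee : ∀ i, e i * e i = 1) (hX : AConf d e X φ v)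
    (h a b : S) (hh : 2 * h = 1) (ha : 4 * (n + 1) * a = n) (hb : (n + 2) * b = a)
    (hda : ∀ i, d i a = 0) (hdb : ∀ i, d i b = 0)
    (Q : (Fin n → Fin n → S) → S → S)
    (hQ : ∀ g f, Q g f = aP d g f + a * aDD d g * f + b * aBox d e (aTr e g) * f) :
    Q (aLie d X g) f = (aV d X (Q g f) + h * (∑ i, d i (X i)) * Q g f)
      - Q g (aV d X f + h * (∑ i, d i (X i)) * f) := by
  have h3 : ∀ i j k l, d i (d j (d k (X l))) = 0 := by
    intro i j k l
    rw [hX.snd]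
    simp only [map_add, map_sub]
    split_ifs <;> simp [Derivation.leibniz, hX.dv, he]
  have hD : ∑ i, d i (X i) = n * φ := by simp [hX.dX]
  have hdD : ∀ j, d j (∑ i, d i (X i)) = n * v j := fun j => by
    rw [hD]; simp [Derivation.leibniz, hX.dφ]
  have hdh : ∀ i, d i h = 0 := fun i => by
    have := congrArg (d i) hh
    have h2 : d i (2 : S) = 0 := by simpa using (d i).map_natCast 2
    simp only [Derivation.leibniz, h2, smul_eq_mul, mul_zero, add_zero, Derivation.map_one_eq_zero] at this
    linear_combination h * this - hh * d i h
  have vadd : ∀ x y, aV d X (x + y) = aV d X x + aV d X y := fun x y => by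
    simp [aV, mul_add, Finset.sum_add_distrib]
  have vmul : ∀ x y, aV d X (x * y) = x * aV d X y + aV d X x * y := fun x y => by
    simp only [aV, Derivation.leibniz, smul_eq_mul, Finset.mul_sum, Finset.sum_mul, ← Finset.sum_add_distrib]
    exact Finset.sum_congr rfl fun _ _ => by ring
  have va : aV d X a = 0 := by simp [aV, hda]
  have vb : aV d X b = 0 := by simp [aV, hdb]
  have padd : ∀ x y, aP d g (x + y) = aP d g x + aP d g y := fun x y => by
    simp only [aP, map_add, mul_add, Finset.sum_add_distrib]; ring
  set D := ∑ i, d i (X i) with hDdef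
  have k1 := aP_lie d hc g X f
  have k2 := aP_mul d g hs (h * D) f (fun i j => by
    simp [Derivation.leibniz, hdh, hdD, hX.dv])
  have k3 := aDD_lie d hc g hs X h3
  have k4 := aTr_lie d e g hs X φ v he hX
  have k5 := aBox_lie d hc e X φ v (aTr e g) he hee hX
  rw [← k4] at k5
  have k6 : ∑ i, ∑ j, ∑ k, d i (d j (X k)) * d k (g i j)
      = 2 * (∑ i, ∑ j, d j (g i j) * v i) - ∑ k, e k * v k * d k (aTr e g) := by
    have t1 : ∑ i, ∑ j, d i (g i j) * v j = ∑ i, ∑ j, d j (g i j) * v i := by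
      rw [Finset.sum_comm]; simp only [hs]
    have t2 : ∑ k, e k * v k * d k (aTr e g) = ∑ i, ∑ k, e i * e k * v k * d k (g i i) := by
      rw [Finset.sum_comm]
      simp only [aTr, map_sum, Finset.mul_sum, Derivation.leibniz, he, smul_eq_mul, mul_zero, add_zero]
      exact Finset.sum_congr rfl fun _ _ => Finset.sum_congr rfl fun _ _ => by ring
    have t3 : ∀ i, ∑ j, ∑ k, (if i = j then e i * e k * v k else 0) * d k (g i j)
        = ∑ k, e i * e k * v k * d k (g i i) := by
      intro i
      rw [Finset.sum_comm]
      simp only [ite_mul, zero_mul, Finset.sum_ite_eq, Finset.mem_univ, if_true]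
    rw [t2]
    simp only [hX.snd, sub_mul, add_mul, Finset.sum_sub_distrib, Finset.sum_add_distrib, t3]
    simp only [ite_mul, zero_mul, Finset.sum_ite_eq', Finset.mem_univ, if_true]
    have t1' : ∑ i, ∑ j, v j * d i (g i j) = ∑ i, ∑ j, d j (g i j) * v i := by
      rw [← t1]; simp only [mul_comm]
    have t1'' : ∑ i, ∑ j, v i * d j (g i j) = ∑ i, ∑ j, d j (g i j) * v i := by
      simp only [mul_comm]
    rw [t1', t1'']; ring
  have k7 : ∑ i, ∑ j, d j (g i j) * d i D = n * ∑ i, ∑ j, d j (g i j) * v i := by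
    simp only [hdD, Finset.mul_sum]
    exact Finset.sum_congr rfl fun _ _ => Finset.sum_congr rfl fun _ _ => by ring
  have k8 : ∑ i, ∑ j, d j (g i j) * d i (h * D) = h * ∑ i, ∑ j, d j (g i j) * d i D := by
    simp only [Derivation.leibniz, hdh, smul_eq_mul, mul_zero, add_zero, Finset.mul_sum]
    exact Finset.sum_congr rfl fun _ _ => Finset.sum_congr rfl fun _ _ => by ring
  have k9 : ∑ i, ∑ j, g i j * d j (h * D) * d i f = h * ∑ i, ∑ j, g i j * d j D * d i f := by
    simp only [Derivation.leibniz, hdh, smul_eq_mul, mul_zero, add_zero, Finset.mul_sum]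
    exact Finset.sum_congr rfl fun _ _ => Finset.sum_congr rfl fun _ _ => by ring
  rw [k8, k9, k7] at k2
  rw [k6, k7] at k3
  simp only [hQ, vadd, vmul, padd, va, vb, k1, k2, k3, k5]
  generalize ∑ i, ∑ j, d j (g i j) * v i = A
  generalize ∑ k, e k * v k * d k (aTr e g) = B
  generalize ∑ i, ∑ j, g i j * d j D * d i f = C
  linear_combination C * hh - h * f * A * ha - B * f * hb + 2 * (n+1) * a * f * A * hh


theorem AConf.add {d : Fin n → Derivation ℝ S S} {e X Y : Fin n → S} {φ ψ : S} {v w : Fin n → S}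
    (hX : AConf d e X φ v) (hY : AConf d e Y ψ w) :
    AConf d e (fun i => X i + Y i) (φ + ψ) (fun i => v i + w i) where
  dφ i := by simp [hX.dφ, hY.dφ]
  dv i j := by simp [hX.dv, hY.dv]
  dX i := by simp [hX.dX, hY.dX]
  conf i j := by
    have h1 := hX.conf i j
    have h2 := hY.conf i j
    simp only [map_add]
    split_ifs at h1 h2 ⊢ <;> linear_combination h1 + h2
  snd i j k := by
    simp only [map_add, hX.snd, hY.snd]
    split_ifs <;> ring

theorem AConf.smul {d : Fin n → Derivation ℝ S S} {e X : Fin n → S} {φ : S} {v : Fin n → S}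
    (c : S) (hc : ∀ i, d i c = 0) (hX : AConf d e X φ v) :
    AConf d e (fun i => c * X i) (c * φ) (fun i => c * v i) where
  dφ i := by simp [hc, Derivation.leibniz, hX.dφ]
  dv i j := by simp [hc, Derivation.leibniz, hX.dv]
  dX i := by simp [hc, Derivation.leibniz, hX.dX]
  conf i j := by
    have h1 := hX.conf i j
    simp only [hc, Derivation.leibniz, smul_eq_mul, mul_zero, add_zero]
    split_ifs at h1 ⊢ <;> linear_combination c * h1
  snd i j k := by
    simp only [hc, Derivation.leibniz, smul_eq_mul, mul_zero, add_zero, hX.snd]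
    split_ifs <;> ring

theorem aconf_zero (d : Fin n → Derivation ℝ S S) (e : Fin n → S) :
    AConf d e (fun _ => 0) 0 (fun _ => 0) := by
  constructor <;> simp

theorem aconf_trans (d : Fin n → Derivation ℝ S S) (e : Fin n → S) (a : Fin n) :
    AConf d e (fun m => if m = a then 1 else 0) 0 (fun _ => 0) := by
  have h : ∀ i m, d i (if m = a then (1 : S) else 0) = 0 := by
    intro i m; split_ifs <;> simp
  constructor <;> simp [h]

theorem aconf_rot (d : Fin n → Derivation ℝ S S) (e : Fin n → S) (he : ∀ i k, d i (e k) = 0)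
    (xs : Fin n → S) (hx : ∀ i j, d i (xs j) = if i = j then 1 else 0) (a b : Fin n) :
    AConf d e (fun m => (if m = b then e a * xs a else 0) - (if m = a then e b * xs b else 0))
      0 (fun _ => 0) := by
  have h : ∀ i m, d i ((if m = b then e a * xs a else 0) - (if m = a then e b * xs b else 0))
      = (if m = b then (if i = a then e a else 0) else 0)
        - (if m = a then (if i = b then e b else 0) else 0) := by
    intro i m; rw [map_sub]; split_ifs <;> simp_all [Derivation.leibniz]
  have h' : ∀ j i m, d j ((if m = b then (if i = a then e a else 0) else 0)
        - (if m = a then (if i = b then e b else 0) else 0)) = 0 := by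
    intro j i m; rw [map_sub]; split_ifs <;> simp [he]
  constructor
  · simp
  · simp
  · intro i j
    simp only [h]
    by_cases h1 : i = a <;> by_cases h2 : i = b <;> by_cases h3 : j = a <;> by_cases h4 : j = b <;>
      simp [h1, h2, h3, h4] <;> (try subst_vars) <;> (try simp_all) <;> (try ring)
  · intro i j k
    simp [h, h']
  · intro i
    rw [h]
    by_cases h1 : i = a <;> by_cases h2 : i = b <;> simp [h1, h2] <;> (try subst_vars) <;> simp_all

theorem aconf_euler (d : Fin n → Derivation ℝ S S) (e : Fin n → S)
    (xs : Fin n → S) (hx : ∀ i j, d i (xs j) = if i = j then 1 else 0) :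
    AConf d e xs 1 (fun _ => 0) := by
  constructor
  · simp
  · simp
  · intro i j
    rw [hx, hx]
    by_cases h : i = j
    · subst h; simp; ring
    · simp [h, Ne.symm h]
  · intro i j k
    rw [hx]; split_ifs <;> simp
  · simp [hx]

theorem aconf_inv (d : Fin n → Derivation ℝ S S) (e : Fin n → S) (he : ∀ i k, d i (e k) = 0)
    (hee : ∀ i, e i * e i = 1)
    (xs : Fin n → S) (hx : ∀ i j, d i (xs j) = if i = j then 1 else 0) (a : Fin n) :
    AConf d e (fun m => (if m = a then ∑ j, e j * xs j * xs j else 0) - 2 * (e a * xs a) * xs m)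
      (-2 * (e a * xs a)) (fun k => if k = a then -2 * e a else 0) := by
  have h2 : ∀ i, d i (2 : S) = 0 := fun i => by
    simpa using (d i).map_natCast 2
  have hs : ∀ k, d k (∑ j, e j * xs j * xs j) = 2 * e k * xs k := by
    intro k
    simp only [map_sum, Derivation.leibniz, he, smul_eq_mul, hx]
    simp [Finset.sum_add_distrib]
    ring
  have h : ∀ k m, d k ((if m = a then ∑ j, e j * xs j * xs j else 0) - 2 * (e a * xs a) * xs m)
      = (if m = a then 2 * e k * xs k else 0) - (if k = a then 2 * e a * xs m else 0)
        - (if k = m then 2 * e a * xs a else 0) := by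
    intro k m
    rw [map_sub]
    simp only [Derivation.leibniz, he, hx, h2, smul_eq_mul]
    by_cases h1 : m = a
    · simp only [h1, if_true, hs]; split_ifs <;> ring
    · simp only [h1, if_false, map_zero]; split_ifs <;> ring
  have h' : ∀ l k m, d l ((if m = a then 2 * e k * xs k else 0) - (if k = a then 2 * e a * xs m else 0)
        - (if k = m then 2 * e a * xs a else 0)) = 
        (if m = a then (if l = k then 2 * e k else 0) else 0)
        - (if k = a then (if l = m then 2 * e a else 0) else 0)
        - (if k = m then (if l = a then 2 * e a else 0) else 0) := by
    intro l k m
    rw [map_sub, map_sub]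
    congr 1
    · congr 1
      · by_cases h1 : m = a <;> simp [h1, Derivation.leibniz, he, hx, h2]
      · by_cases h1 : k = a <;> simp [h1, Derivation.leibniz, he, hx, h2]
    · by_cases h1 : k = m <;> simp [h1, Derivation.leibniz, he, hx, h2]
  constructor
  · intro i
    simp only [Derivation.leibniz, map_neg, he, hx, h2, smul_eq_mul]
    split_ifs <;> ring
  · intro i j
    split_ifs <;> simp [Derivation.leibniz, he, h2]
  · intro i j
    simp only [h]
    by_cases hij : i = j
    · subst hij
      by_cases h1 : i = a
      · subst h1; simp; ring
      · simp [h1]; ring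
    · by_cases h1 : i = a
      · subst h1; simp [hij, Ne.symm hij]; ring
      · by_cases h3 : j = a
        · subst h3; simp [hij, Ne.symm hij]; ring
        · simp [hij, Ne.symm hij, h1, h3]
  · intro l k m
    simp only [h, h']
    by_cases h1 : m = a
    · subst h1
      have := hee m
      by_cases h3 : l = k
      · subst h3
        by_cases h4 : l = m
        · subst h4; simp; linear_combination -2 * e l * this
        · simp [h4, Ne.symm h4]; linear_combination -2 * e l * this
      · by_cases h4 : l = m
        · subst h4; simp [h3, Ne.symm h3]
        · by_cases h5 : k = m
          · subst h5; simp [h3, Ne.symm h3]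
          · simp [h3, h4, h5, Ne.symm h4, Ne.symm h5]
    · simp only [h1, if_false, mul_zero, ite_self, eq_comm (a := m)]
      split_ifs <;> ring
  · intro i
    rw [h]
    by_cases h1 : i = a
    · subst h1; simp; try ring
    · simp [h1]; try ring

end abstractPart

section concretePart

def smSub (n : ℕ) : Subalgebra ℝ ((Fin n → ℝ) → ℝ) where
  carrier := {f | ContDiff ℝ (⊤ : ℕ∞) f}
  mul_mem' := by
    intro a b ha hb
    simp only [Set.mem_setOf_eq] at *
    exact ContDiff.mul ha hb
  add_mem' := by
    intro a b ha hb
    simp only [Set.mem_setOf_eq] at *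
    exact ContDiff.add ha hb
  algebraMap_mem' := fun r => (contDiff_const : ContDiff ℝ (⊤ : ℕ∞) fun _ : Fin n → ℝ => r)

variable {n : ℕ}

theorem smSub_cd (f : smSub n) : ContDiff ℝ (⊤ : ℕ∞) f.1 := f.2

theorem smSub_diff (f : smSub n) (x : Fin n → ℝ) : DifferentiableAt ℝ (f : (Fin n → ℝ) → ℝ) x :=
  ((smSub_cd f).differentiable (by simp)) x

theorem pd_smooth (i : Fin n) {f : (Fin n → ℝ) → ℝ} (hf : ContDiff ℝ (⊤ : ℕ∞) f) :
    ContDiff ℝ (⊤ : ℕ∞) (pd i f) := by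
  have h : ContDiff ℝ (⊤ : ℕ∞) (fderiv ℝ f) := hf.fderiv_right (by simp)
  exact h.clm_apply contDiff_const

noncomputable def smD (i : Fin n) : Derivation ℝ (smSub n) (smSub n) :=
  Derivation.mk'
    { toFun := fun f => ⟨pd i f, pd_smooth i (smSub_cd f)⟩
      map_add' := fun f g => by
        ext x
        change fderiv ℝ ((f : (Fin n → ℝ) → ℝ) + (g : (Fin n → ℝ) → ℝ)) x _ = fderiv ℝ _ x _ + fderiv ℝ _ x _
        rw [fderiv_add (smSub_diff f x) (smSub_diff g x)]; rfl
      map_smul' := fun c f => by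
        ext x
        change fderiv ℝ (c • (f : (Fin n → ℝ) → ℝ)) x _ = c • fderiv ℝ _ x _
        rw [fderiv_const_smul (smSub_diff f x)]; rfl }
    (fun f g => by
        ext x
        change fderiv ℝ ((f : (Fin n → ℝ) → ℝ) * (g : (Fin n → ℝ) → ℝ)) x _
          = f.1 x * fderiv ℝ _ x _ + g.1 x * fderiv ℝ _ x _
        rw [fderiv_mul (smSub_diff f x) (smSub_diff g x)]; rfl)

theorem smD_coe (i : Fin n) (f : smSub n) : ((smD i f : smSub n) : (Fin n → ℝ) → ℝ) = pd i f := rfl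

theorem smD_comm (i j : Fin n) (f : smSub n) : smD i (smD j f) = smD j (smD i f) := by
  ext x
  change fderiv ℝ (fun y => fderiv ℝ f.1 y (Pi.single j 1)) x (Pi.single i 1) =
    fderiv ℝ (fun y => fderiv ℝ f.1 y (Pi.single i 1)) x (Pi.single j 1)
  have h : ContDiff ℝ (⊤ : ℕ∞) (fderiv ℝ f.1) := (smSub_cd f).fderiv_right (by simp)
  have hd : DifferentiableAt ℝ (fderiv ℝ f.1) x := (h.differentiable (by simp)) x
  have hsym : IsSymmSndFDerivAt ℝ f.1 x :=
    (smSub_cd f).contDiffAt.isSymmSndFDerivAt (by simp; exact WithTop.coe_le_coe.2 (le_top : (2 : ℕ∞) ≤ ⊤))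
  rw [fderiv_clm_apply hd (differentiableAt_const _), fderiv_clm_apply hd (differentiableAt_const _)]
  simp
  exact hsym _ _

def smX (j : Fin n) : smSub n := ⟨fun x => x j, (contDiff_apply ℝ ℝ j : ContDiff ℝ (⊤ : ℕ∞) fun x : Fin n → ℝ => x j)⟩

def smC (n : ℕ) (c : ℝ) : smSub n := algebraMap ℝ (smSub n) c

theorem smC_apply (c : ℝ) (x : Fin n → ℝ) : (smC n c).1 x = c := rfl

theorem smD_C (i : Fin n) (c : ℝ) : smD i (smC n c) = 0 := (smD i).map_algebraMap c

theorem smD_X (i j : Fin n) : smD i (smX j) = if i = j then 1 else 0 := by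
  ext x
  change fderiv ℝ (fun y : Fin n → ℝ => y j) x (Pi.single i 1) = _
  have hj : HasFDerivAt (fun y : Fin n → ℝ => y j)
      (ContinuousLinearMap.proj (R := ℝ) (φ := fun _ : Fin n => ℝ) j) x :=
    (ContinuousLinearMap.proj (R := ℝ) (φ := fun _ : Fin n => ℝ) j).hasFDerivAt
  rw [hj.fderiv]
  by_cases h : i = j
  · subst h; simp
  · simp [h, Ne.symm h]

theorem sm_ev_sum {ι : Type*} (s : Finset ι) (F : ι → smSub n) (x : Fin n → ℝ) :
    (∑ i ∈ s, F i).1 x = ∑ i ∈ s, (F i).1 x := by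
  have : (∑ i ∈ s, F i).1 = ∑ i ∈ s, (F i).1 := by
    simpa using map_sum (smSub n).val F s
  rw [this, Finset.sum_apply]

theorem conf_span (p q : ℕ) (Xv : Fin (p + q) → (Fin (p + q) → ℝ) → ℝ)
    (hX : Xv ∈ Submodule.span ℝ (confGenSm p q)) :
    ∃ (Y : Fin (p + q) → smSub (p + q)) (φ : smSub (p + q)) (v : Fin (p + q) → smSub (p + q)),
      (∀ i, (Y i).1 = Xv i) ∧ AConf smD (fun i => smC _ (etaSgn p q i)) Y φ v := by
  have he : ∀ i k : Fin (p + q), smD i (smC (p + q) (etaSgn p q k)) = 0 := fun i k => smD_C i _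
  have hee : ∀ i : Fin (p + q), smC (p + q) (etaSgn p q i) * smC (p + q) (etaSgn p q i) = 1 := by
    intro i
    rw [smC, ← map_mul, etaSgn]
    split_ifs <;> simp
  induction hX using Submodule.span_induction with
  | mem X h =>
    rcases h with ((⟨a, rfl⟩ | ⟨⟨a, b⟩, rfl⟩) | h) | ⟨a, rfl⟩
    · refine ⟨_, _, _, ?_, aconf_trans smD _ a⟩
      intro i; funext x; dsimp only; split_ifs <;> rfl
    · refine ⟨_, _, _, ?_, aconf_rot smD _ he smX smD_X a b⟩
      intro i; funext x; dsimp only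
      split_ifs <;> rfl
    · rw [Set.mem_singleton_iff] at h
      subst h
      exact ⟨_, _, _, fun i => rfl, aconf_euler smD _ smX smD_X⟩
    · refine ⟨_, _, _, ?_, aconf_inv smD _ he hee smX smD_X a⟩
      intro i; funext x; dsimp only
      split_ifs
      · change (∑ j, _ : smSub (p + q)).1 x - _ = _
        rw [sm_ev_sum]; rfl
      · rfl
  | zero => exact ⟨_, _, _, fun i => rfl, aconf_zero smD _⟩
  | add X Y _ _ h1 h2 =>
    obtain ⟨Y1, φ1, v1, e1, c1⟩ := h1
    obtain ⟨Y2, φ2, v2, e2, c2⟩ := h2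
    refine ⟨_, _, _, ?_, c1.add c2⟩
    intro i
    rw [Pi.add_apply, ← e1, ← e2]; rfl
  | smul c X _ h1 =>
    obtain ⟨Y1, φ1, v1, e1, c1⟩ := h1
    refine ⟨_, _, _, ?_, c1.smul (smC _ c) (fun i => smD_C i c)⟩
    intro i
    rw [Pi.smul_apply, ← e1]; rfl

noncomputable def smQ (p q : ℕ) (g : Fin (p + q) → Fin (p + q) → smSub (p + q))
    (f : smSub (p + q)) : smSub (p + q) :=
  aP smD g f + smC _ (((p + q : ℕ) : ℝ) / (4 * ((p + q : ℕ) + 1))) * aDD smD g * f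
    + smC _ (((p + q : ℕ) : ℝ) / (4 * ((p + q : ℕ) + 1) * ((p + q : ℕ) + 2)))
      * aBox smD (fun i => smC _ (etaSgn p q i)) (aTr (fun i => smC _ (etaSgn p q i)) g) * f

theorem sm_add (f g : smSub n) (x : Fin n → ℝ) : (f + g).1 x = f.1 x + g.1 x := rfl
theorem sm_sub (f g : smSub n) (x : Fin n → ℝ) : (f - g).1 x = f.1 x - g.1 x := rfl
theorem sm_mul (f g : smSub n) (x : Fin n → ℝ) : (f * g).1 x = f.1 x * g.1 x := rfl
theorem sm_D (i : Fin n) (f : smSub n) : (smD i f).1 = pd i f.1 := rfl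

theorem smQ_coe (p q : ℕ) (ℏ : ℝ) (g : Fin (p + q) → Fin (p + q) → smSub (p + q))
    (f : smSub (p + q)) :
    Qconf p q ℏ (fun i j => (g i j).1) f.1 = (smC _ (-ℏ ^ 2) * smQ p q g f).1 := by
  funext x
  have ht : (fun y => ∑ i, etaSgn p q i * (g i i).1 y)
      = (aTr (fun i => smC _ (etaSgn p q i)) g).1 := by
    funext y
    rw [aTr, sm_ev_sum]; rfl
  unfold Qconf
  rw [ht]
  simp only [smQ, aP, aDD, aBox, sm_add, sm_mul, sm_ev_sum, sm_D, smC_apply]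

theorem lie_coe (X : Fin n → smSub n) (g : Fin n → Fin n → smSub n) :
    lieDer (fun i => (X i).1) (fun i j => (g i j).1) = fun i j => (aLie smD X g i j).1 := by
  funext i j x
  simp only [lieDer, aLie, sm_ev_sum, sm_sub, sm_mul, sm_D]

theorem half_coe (X : Fin n → smSub n) (f : smSub n) :
    halfDensAct (fun i => (X i).1) f.1
      = (aV smD X f + smC _ (1 / 2) * (∑ i, smD i (X i)) * f).1 := by
  funext x
  simp only [halfDensAct, aV, sm_add, sm_mul, sm_ev_sum, sm_D, smC_apply]

end concretePart

/-- Conformal equivariance of the quantization `Q` of quadratic symbols at weights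
`λ = μ = 1/2`: for every `X` in the span of the conformal generators,
`Q(L_X g) = ℓ_X ∘ Q(g) − Q(g) ∘ ℓ_X` on smooth functions. -/
theorem stmt8 (p q : ℕ) (hn : 2 ≤ p + q) (ℏ : ℝ)
    (g : Fin (p + q) → Fin (p + q) → (Fin (p + q) → ℝ) → ℝ)
    (hg : ∀ i j, ContDiff ℝ (⊤ : ℕ∞) (g i j)) (hsym : ∀ i j, g i j = g j i)
    (Xv : Fin (p + q) → (Fin (p + q) → ℝ) → ℝ)
    (hX : Xv ∈ Submodule.span ℝ (confGenSm p q))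
    (f : (Fin (p + q) → ℝ) → ℝ) (hf : ContDiff ℝ (⊤ : ℕ∞) f) (x : Fin (p + q) → ℝ) :
    Qconf p q ℏ (lieDer Xv g) f x
      = halfDensAct Xv (Qconf p q ℏ g f) x - Qconf p q ℏ g (halfDensAct Xv f) x := by
  obtain ⟨Y, φ, v, eY, hY⟩ := conf_span p q Xv hX
  obtain rfl : (fun i => (Y i).1) = Xv := funext eY
  let G : Fin (p + q) → Fin (p + q) → smSub (p + q) := fun i j => ⟨g i j, hg i j⟩
  let F : smSub (p + q) := ⟨f, hf⟩
  have hG : (fun i j => (G i j).1) = g := rfl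
  have hF : F.1 = f := rfl
  have hn1 : (((p + q : ℕ) : ℝ) + 1) ≠ 0 := by positivity
  have hn2 : (((p + q : ℕ) : ℝ) + 2) ≠ 0 := by positivity
  have hsm : ∀ i j, G i j = G j i := fun i j => Subtype.ext (hsym i j)
  have key := aMain smD smD_comm (fun i => smC _ (etaSgn p q i)) G hsm Y φ v F
    (fun i k => smD_C i _)
    (by
      intro i
      ext x
      change etaSgn p q i * etaSgn p q i = 1
      unfold etaSgn
      split_ifs <;> simp) hY (smC _ (1 / 2))
    (smC _ (((p + q : ℕ) : ℝ) / (4 * ((p + q : ℕ) + 1))))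
    (smC _ (((p + q : ℕ) : ℝ) / (4 * ((p + q : ℕ) + 1) * ((p + q : ℕ) + 2))))
    (by
      ext x
      change (2 : ℝ) * (1 / 2) = 1
      norm_num)
    (by
      ext x
      change (4 : ℝ) * (((p + q : ℕ) : ℝ) + 1) * (((p + q : ℕ) : ℝ) / (4 * ((p + q : ℕ) + 1)))
        = ((p + q : ℕ) : ℝ)
      field_simp)
    (by
      ext x
      change (((p + q : ℕ) : ℝ) + 2) * (((p + q : ℕ) : ℝ) / (4 * ((p + q : ℕ) + 1) * ((p + q : ℕ) + 2)))
        = (((p + q : ℕ) : ℝ) / (4 * ((p + q : ℕ) + 1)))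
      field_simp)
    (fun i => smD_C i _) (fun i => smD_C i _) (smQ p q) (fun _ _ => rfl)
  rw [← hG, ← hF, lie_coe, half_coe, smQ_coe, smQ_coe, half_coe, smQ_coe]
  have hV : aV smD Y (smC _ (-ℏ ^ 2) * smQ p q G F) = smC _ (-ℏ ^ 2) * aV smD Y (smQ p q G F) := by
    simp only [aV, Derivation.leibniz, smD_C, smul_eq_mul, mul_zero, add_zero, Finset.mul_sum]
    exact Finset.sum_congr rfl fun _ _ => by ring
  rw [hV, ← sm_sub]
  refine congrArg (fun u : smSub (p + q) => u.1 x) ?_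
  rw [key]
  ring
end
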